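/- arXiv:2408.12876 — 2 statements merged into one kernel-verified Lean document; each statement's English description precedes it below -/
import Mathlib

section
/- There exist an integer L ≥ 1 and a constant c₀ > 0 such that for every n ∈ ℕ* and every ℓ ∈ ℤ with |ℓ| > L·n, one has |a^{⋆n}_ℓ| ≤ exp(−c₀·n − c₀·|ℓ|). -/
open Complex

/-- Convolution of two complex-valued sequences over `ℤ`. -/
noncomputable def conv (a b : ℤ → ℂ) : ℤ → ℂ := fun ℓ => ∑' ℓ' : ℤ, a (ℓ - ℓ') * b ℓ'

/-- `iterConv a n` is the iterated convolution `a^{⋆(n+1)}`: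
`iterConv a 0 = a^{⋆1} = a` and `iterConv a (n+1) = iterConv a n ⋆ a`. -/
noncomputable def iterConv (a : ℤ → ℂ) : ℕ → ℤ → ℂ
  | 0 => a
  | n + 1 => conv (iterConv a n) a

lemma iterConv_bound (a : ℤ → ℂ) (r M : ℝ) (hr : 1 ≤ r)
    (hs : HasSum (fun ℓ : ℤ => ‖a ℓ‖ * r ^ ℓ.natAbs) M) (n : ℕ) :
    ∀ ℓ : ℤ, ‖iterConv a n ℓ‖ * r ^ ℓ.natAbs ≤ M ^ (n + 1) := by
  have hr0 : 0 < r := by linarith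
  have hM : 0 ≤ M := hs.nonneg fun ℓ => by positivity
  induction n with
  | zero =>
    intro ℓ
    have := le_hasSum hs ℓ (fun j _ => by positivity)
    simpa [iterConv] using this
  | succ n ih =>
    intro ℓ
    have hb : ∀ k : ℤ, ‖iterConv a n (ℓ - k) * a k‖ ≤
        (M ^ (n + 1) / r ^ ℓ.natAbs) * (‖a k‖ * r ^ k.natAbs) := by
      intro k
      have h1 := ih (ℓ - k)
      have h2 : r ^ ℓ.natAbs ≤ r ^ (ℓ - k).natAbs * r ^ k.natAbs := by
        rw [← pow_add]
        exact pow_le_pow_right₀ hr (by omega)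
      rw [norm_mul, div_mul_eq_mul_div, le_div_iff₀ (by positivity)]
      calc ‖iterConv a n (ℓ - k)‖ * ‖a k‖ * r ^ ℓ.natAbs
          ≤ ‖iterConv a n (ℓ - k)‖ * ‖a k‖ * (r ^ (ℓ - k).natAbs * r ^ k.natAbs) := by gcongr
        _ = (‖iterConv a n (ℓ - k)‖ * r ^ (ℓ - k).natAbs) * (‖a k‖ * r ^ k.natAbs) := by ring
        _ ≤ _ := by gcongr
    have h3 := tsum_of_norm_bounded (hs.mul_left (M ^ (n + 1) / r ^ ℓ.natAbs)) hb
    have h4 : ‖iterConv a (n + 1) ℓ‖ ≤ M ^ (n + 1) / r ^ ℓ.natAbs * M := h3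
    rw [div_mul_eq_mul_div, le_div_iff₀ (by positivity)] at h4
    rw [pow_succ M (n + 1)]
    exact h4

/-- There exist an integer `L ≥ 1` and `c₀ > 0` such that for all `n ≥ 1` and `ℓ ∈ ℤ` with
`|ℓ| > L n`, one has `|a^{⋆n}_ℓ| ≤ exp (-c₀ n - c₀ |ℓ|)`. -/
theorem far_field_bound
    (a : ℤ → ℂ) (ha : Summable fun ℓ : ℤ => ‖a ℓ‖)
    (ε : ℝ) (hε : 0 < ε) (F : ℂ → ℂ)
    (hFsum : ∀ ζ : ℂ, 1 - ε < ‖ζ‖ → ‖ζ‖ < 1 + ε →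
      HasSum (fun ℓ : ℤ => a ℓ * ζ ^ ℓ) (F ζ))
    (hFhol : DifferentiableOn ℂ F {ζ : ℂ | 1 - ε < ‖ζ‖ ∧ ‖ζ‖ < 1 + ε})
    (hFsup : IsLUB {y : ℝ | ∃ κ : ℂ, ‖κ‖ = 1 ∧ y = ‖F κ‖} 1) :
    ∃ L : ℕ, 1 ≤ L ∧ ∃ c₀ : ℝ, 0 < c₀ ∧
      ∀ n : ℕ, 1 ≤ n → ∀ ℓ : ℤ, (L : ℤ) * n < |ℓ| →
        ‖iterConv a (n - 1) ℓ‖ ≤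
          Real.exp (-c₀ * n - c₀ * ((|ℓ| : ℤ) : ℝ)) := by
  obtain ⟨r, hr1, hrε, hrε'⟩ : ∃ r : ℝ, 1 < r ∧ r < 1 + ε ∧ 1 - ε < r⁻¹ := by
    refine ⟨1 + ε / 2, by linarith, by linarith, ?_⟩
    rw [inv_eq_one_div, lt_div_iff₀ (by linarith)]
    nlinarith
  have hr0 : 0 < r := by linarith
  have hinv : r⁻¹ < 1 := inv_lt_one_of_one_lt₀ hr1
  have s1 := (hFsum (r : ℂ) (by rw [norm_real, Real.norm_of_nonneg hr0.le]; linarith)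
    (by rw [norm_real, Real.norm_of_nonneg hr0.le]; linarith)).summable.norm
  have s2 := (hFsum ((r⁻¹ : ℝ) : ℂ)
    (by rw [norm_real, Real.norm_of_nonneg (inv_pos.2 hr0).le]; linarith)
    (by rw [norm_real, Real.norm_of_nonneg (inv_pos.2 hr0).le]; linarith)).summable.norm
  have s3 : Summable (fun ℓ : ℤ => ‖a ℓ‖ * r ^ ℓ.natAbs) := by
    refine Summable.of_nonneg_of_le (fun ℓ => by positivity) (fun ℓ => ?_) (s1.add s2)
    rw [norm_mul, norm_mul, norm_zpow, norm_zpow, norm_real, norm_real,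
      Real.norm_of_nonneg hr0.le, Real.norm_of_nonneg (inv_pos.2 hr0).le, ← mul_add]
    refine mul_le_mul_of_nonneg_left ?_ (norm_nonneg _)
    have p1 : 0 < r ^ ℓ := by positivity
    have p2 : 0 < r⁻¹ ^ ℓ := by positivity
    rcases Int.natAbs_eq ℓ with h | h
    · have : r ^ ℓ.natAbs = r ^ ℓ := by rw [← zpow_natCast, ← h]
      linarith
    · have : r ^ ℓ.natAbs = r⁻¹ ^ ℓ := by
        rw [inv_zpow', ← zpow_natCast]
        congr 1
        omega
      linarith
  obtain ⟨M, hM⟩ := s3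
  have hM0 : 0 ≤ M := hM.nonneg fun ℓ => by positivity
  have hs : 0 < Real.log r := Real.log_pos hr1
  set s := Real.log r with hsdef
  obtain ⟨L, hL⟩ := exists_nat_ge ((2 * M + s) / s)
  rw [div_le_iff₀ hs] at hL
  refine ⟨L + 1, by omega, s / 2, by linarith, ?_⟩
  intro n hn ℓ hℓ
  have hb := iterConv_bound a r M hr1.le hM (n - 1) ℓ
  rw [Nat.sub_add_cancel hn] at hb
  have e1 : r ^ ℓ.natAbs = Real.exp (s * ((|ℓ| : ℤ) : ℝ)) := by
    rw [Int.abs_eq_natAbs, Int.cast_natCast, mul_comm, Real.exp_nat_mul, hsdef, Real.exp_log hr0]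
  have e2 : M ^ n ≤ Real.exp (n * M) := by
    rw [Real.exp_nat_mul]
    exact pow_le_pow_left₀ hM0 (by linarith [Real.add_one_le_exp M]) n
  rw [e1, ← le_div_iff₀ (Real.exp_pos _)] at hb
  refine hb.trans ((div_le_div_of_nonneg_right e2 (Real.exp_pos _).le).trans ?_)
  rw [← Real.exp_sub, Real.exp_le_exp]
  have hℓ' : ((L : ℝ) + 1) * n < ((|ℓ| : ℤ) : ℝ) := by exact_mod_cast hℓ
  have hn0 : (0 : ℝ) ≤ n := Nat.cast_nonneg n
  nlinarith [mul_le_mul_of_nonneg_right hL hn0, mul_lt_mul_of_pos_left hℓ' hs, mul_nonneg hs.le hn0]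
end

section
/- There exists an integer L ≥ 1 such that for every M ∈ ℕ there exist constants C_M > 0 and c_M > 0 with the following property: for every n ∈ ℕ* and every ℓ ∈ ℤ with |ℓ| ≤ L·n, | a^{⋆n}_ℓ − Σ_{k=1}^{K} Σ_{m=0}^{M} κ_k^{−ℓ} F_a(κ_k)^n n^{−(m+1)/(2μ_k)} (P_{k,m}(−d/dx) H_{2μ_k}^{β_k})((ℓ − α_k n)/n^{1/(2μ_k)}) | ≤ C_M Σ_{k=1}^{K} n^{−(M+2)/(2μ_k)} exp( −c_M (|ℓ − α_k n| / n^{1/(2μ_k)})^{2μ_k/(2μ_k−1)} ). -/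
open Complex

/-- The generalized Gaussian `H_{2μ}^β (x) = (1/2π) ∫_ℝ e^{-i x θ} e^{-β θ^{2μ}} dθ`. -/
noncomputable def Hfun (μ : ℕ) (β : ℂ) : ℝ → ℂ :=
  fun x => (1 / (2 * Real.pi : ℂ)) *
    ∫ θ : ℝ, Complex.exp (-Complex.I * x * θ) * Complex.exp (-β * (θ : ℂ) ^ (2 * μ))

/-- The function `(P_m (-d/dx)) H` where
`P_m (X) = X^m ∑_{⟨ν⟩ = m} X^{2μ|ν|}/ν! ∏_{j ≥ 1} (γ_{2μ+j}/(2μ+j)!)^{ν_j}`,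
the sum running over finitely supported sequences `ν` of nonnegative integers with
`⟨ν⟩ = ∑_j j ν_j = m`, encoded by partitions `p` of `m` (`ν_j` being the number of parts
of `p` equal to `j`); in particular `P_0 = 1`. -/
noncomputable def PdiffH (μ : ℕ) (γ : ℕ → ℂ) (m : ℕ) (H : ℝ → ℂ) : ℝ → ℂ :=
  fun x => ∑ p : Nat.Partition m,
    (-1 : ℂ) ^ (m + 2 * μ * Multiset.card p.parts) *
      ((∏ j ∈ p.parts.toFinset, (Nat.factorial (Multiset.count j p.parts) : ℂ))⁻¹ *
        ∏ j ∈ p.parts.toFinset,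
          (γ (2 * μ + j) / (Nat.factorial (2 * μ + j) : ℂ)) ^ Multiset.count j p.parts) *
      iteratedDeriv (m + 2 * μ * Multiset.card p.parts) H x

section

lemma iterConv_spec (a : ℤ → ℂ) (ha : Summable fun ℓ : ℤ => ‖a ℓ‖) (n : ℕ) :
    (Summable fun ℓ : ℤ => ‖iterConv a n ℓ‖) ∧ ∀ z w : ℂ, ‖z‖ = 1 →
      HasSum (fun ℓ : ℤ => a ℓ * z ^ ℓ) w →
      HasSum (fun ℓ : ℤ => iterConv a n ℓ * z ^ ℓ) (w ^ (n + 1)) := by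
  induction n with
  | zero => exact ⟨ha, fun z w _ h => by simpa [iterConv] using h⟩
  | succ n ih =>
    obtain ⟨ih1, ih2⟩ := ih
    let e : ℤ × ℤ ≃ ℤ × ℤ :=
      { toFun := fun q => (q.1 - q.2, q.2)
        invFun := fun q => (q.1 + q.2, q.2)
        left_inv := fun q => by simp
        right_inv := fun q => by simp }
    have hs : Summable fun q : ℤ × ℤ => ‖iterConv a n q.1 * a q.2‖ := 
      (summable_mul_of_summable_norm ih1 ha).norm
    have hs2 : Summable fun q : ℤ × ℤ => ‖iterConv a n (q.1 - q.2) * a q.2‖ := 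
      (e.summable_iff (f := fun q : ℤ × ℤ => ‖iterConv a n q.1 * a q.2‖)).2 hs
    constructor
    · have h3 := hs2.prod
      refine h3.of_nonneg_of_le (fun _ => norm_nonneg _) (fun ℓ => ?_)
      exact norm_tsum_le_tsum_norm (hs2.prod_factor ℓ)
    · intro z w hz hw
      have hz0 : z ≠ 0 := by rintro rfl; simp at hz
      have h1 := ih2 z w hz hw
      have hn1 : Summable fun ℓ : ℤ => ‖iterConv a n ℓ * z ^ ℓ‖ := by
        simpa [norm_mul, norm_zpow, hz] using ih1
      have hn2 : Summable fun ℓ : ℤ => ‖a ℓ * z ^ ℓ‖ := by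
        simpa [norm_mul, norm_zpow, hz] using ha
      have hsm : Summable fun q : ℤ × ℤ =>
          (iterConv a n q.1 * z ^ q.1) * (a q.2 * z ^ q.2) :=
        summable_mul_of_summable_norm (f := fun ℓ => iterConv a n ℓ * z ^ ℓ)
          (g := fun ℓ => a ℓ * z ^ ℓ) hn1 hn2
      have h4 : HasSum (fun q : ℤ × ℤ =>
          (iterConv a n q.1 * z ^ q.1) * (a q.2 * z ^ q.2)) (w ^ (n + 1) * w) :=
        HasSum.mul (f := fun ℓ => iterConv a n ℓ * z ^ ℓ) (g := fun ℓ => a ℓ * z ^ ℓ) h1 hw hsm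
      have h5 := (e.hasSum_iff).2 h4
      have h6 := h5.prod_fiberwise (g := fun ℓ => iterConv a (n+1) ℓ * z ^ ℓ) (fun ℓ => by
        have h7 : HasSum (fun ℓ' => iterConv a n (ℓ - ℓ') * a ℓ') (iterConv a (n+1) ℓ) :=
          ((hs2.prod_factor ℓ).of_norm).hasSum
        refine (h7.mul_right (z ^ ℓ)).congr_fun ?_ 
        intro ℓ'
        simp only [Function.comp, e, Equiv.coe_fn_mk]
        have : z ^ ℓ = z ^ (ℓ - ℓ') * z ^ ℓ' := by rw [← zpow_add₀ hz0]; simp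
        rw [this]; ring)
      rw [pow_succ]
      exact h6

lemma coeff_integral (b : ℤ → ℂ) (hb : Summable fun ℓ : ℤ => ‖b ℓ‖) (G : ℂ → ℂ)
    (hG : ∀ z : ℂ, ‖z‖ = 1 → HasSum (fun ℓ : ℤ => b ℓ * z ^ ℓ) (G z)) (ℓ : ℤ) :
    b ℓ = (1 / (2 * Real.pi : ℂ)) *
      ∫ θ in (-Real.pi)..Real.pi, G (exp (I * θ)) * (exp (I * θ)) ^ (-ℓ) := by
  have hn : ∀ θ : ℝ, ‖exp (I * θ)‖ = 1 := fun θ => by rw [mul_comm]; exact norm_exp_ofReal_mul_I θ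
  let f : ℤ → C(ℝ, ℂ) := fun j => ⟨fun θ => b j * exp (I * θ) ^ j * exp (I * θ) ^ (-ℓ), by
    have : ∀ (k : ℤ) (θ : ℝ), exp (I * θ) ^ k = exp (k * (I * θ)) := fun k θ => by
      rw [← Complex.exp_int_mul]
    simp only [this]; fun_prop⟩
  have h1 : HasSum (fun j => ∫ θ in (-Real.pi)..Real.pi, f j θ)
      (∫ θ in (-Real.pi)..Real.pi, ∑' j, f j θ) := by
    apply intervalIntegral.hasSum_intervalIntegral_of_summable_norm
    refine hb.of_nonneg_of_le (fun _ => norm_nonneg _) (fun j => ?_)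
    rw [ContinuousMap.norm_le _ (norm_nonneg _)]
    intro x
    simp [f, norm_zpow, hn]
  have h2 : ∀ θ : ℝ, ∑' j, f j θ = G (exp (I * θ)) * (exp (I * θ)) ^ (-ℓ) := fun θ =>
    ((hG _ (hn θ)).mul_right _).tsum_eq
  have h3 : ∀ j, ∫ θ in (-Real.pi)..Real.pi, f j θ = if j = ℓ then b ℓ * (2 * Real.pi) else 0 := by
    intro j
    have h4 : ∀ θ : ℝ, f j θ = b j * exp ((((j - ℓ : ℤ) : ℂ) * I) * θ) := fun θ => by
      simp only [f, ContinuousMap.coe_mk]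
      rw [mul_assoc, ← zpow_add₀ (exp_ne_zero _), ← Complex.exp_int_mul]
      congr 2; push_cast; ring
    simp only [h4]
    rw [intervalIntegral.integral_const_mul]
    split_ifs with hj
    · subst hj; simp; left; ring
    · have hne : (((j - ℓ : ℤ) : ℂ) * I) ≠ 0 := by
        simp [I_ne_zero, sub_eq_zero]; exact_mod_cast hj
      rw [integral_exp_mul_complex hne]
      have : exp ((((j - ℓ : ℤ) : ℂ) * I) * (Real.pi : ℝ)) =
          exp ((((j - ℓ : ℤ) : ℂ) * I) * ((-Real.pi : ℝ) : ℂ)) := by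
        rw [Complex.exp_eq_exp_iff_exists_int]
        exact ⟨j - ℓ, by push_cast; ring⟩
      rw [this]; simp
  simp only [h2, h3] at h1
  have h5 := (hasSum_ite_eq ℓ (b ℓ * (2 * Real.pi : ℂ))).unique h1
  rw [← h5]
  have : (Real.pi : ℂ) ≠ 0 := by exact_mod_cast Real.pi_ne_zero
  field_simp

end

section

lemma arc_one (κ : ℂ) (hκ : ‖κ‖ = 1) (r : ℝ) (hr : 0 < r) (hrpi : r < Real.pi) (Φ : ℂ → ℂ) :
    ∫ ξ in (-r)..r, Φ (κ * exp (I * ξ)) = ∫ θ in (-Real.pi)..Real.pi,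
      {θ : ℝ | Real.cos r ≤ (exp (I * θ) / κ).re}.indicator (fun θ : ℝ => Φ (exp (I * θ))) θ := by
  have hκ0 : κ ≠ 0 := by rintro rfl; simp at hκ
  set f : ℝ → ℂ := {θ : ℝ | Real.cos r ≤ (exp (I * θ) / κ).re}.indicator
    (fun θ : ℝ => Φ (exp (I * θ))) with hf
  have hper0 : ∀ θ : ℝ, exp (I * ((θ + 2 * Real.pi : ℝ) : ℂ)) = exp (I * θ) := by
    intro θ
    rw [Complex.exp_eq_exp_iff_exists_int]
    exact ⟨1, by push_cast; ring⟩
  have hper : Function.Periodic f (2 * Real.pi) := by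
    intro θ
    simp only [hf, Set.indicator, Set.mem_ofPred_eq, hper0]
  have hk : exp (I * (arg κ : ℂ)) = κ := by
    have := Complex.norm_mul_exp_arg_mul_I κ
    rw [hκ] at this; rw [mul_comm]; simpa using this
  have h1 : ∫ θ in (-Real.pi)..Real.pi, f θ = ∫ ξ in (-Real.pi)..Real.pi, f (ξ + arg κ) := by
    rw [intervalIntegral.integral_comp_add_right]
    have := hper.intervalIntegral_add_eq (-Real.pi) (-Real.pi + arg κ)
    convert this using 2 <;> ring
  have h2 : ∀ ξ ∈ Set.Ioc (-Real.pi) Real.pi, f (ξ + arg κ) =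
      (Set.Icc (-r) r).indicator (fun ξ : ℝ => Φ (κ * exp (I * ξ))) ξ := by
    intro ξ hξ
    have e1 : exp (I * ((ξ + arg κ : ℝ) : ℂ)) = κ * exp (I * ξ) := by
      push_cast; rw [mul_add, exp_add, hk, mul_comm]
    have e2 : (κ * exp (I * ξ) / κ).re = Real.cos ξ := by
      rw [mul_div_cancel_left₀ _ hκ0, mul_comm, exp_ofReal_mul_I_re]
    simp only [hf, Set.indicator, Set.mem_ofPred_eq, e1, e2]
    have e3 : Real.cos r ≤ Real.cos ξ ↔ ξ ∈ Set.Icc (-r) r := by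
      rw [← Real.cos_abs ξ, Set.mem_Icc, ← abs_le]
      exact Real.strictAntiOn_cos.le_iff_ge ⟨hr.le, hrpi.le⟩ ⟨abs_nonneg _, abs_le.2 ⟨hξ.1.le, hξ.2⟩⟩
    simp only [e3]
  have hpp : -Real.pi ≤ Real.pi := by linarith [Real.pi_pos]
  rw [h1, intervalIntegral.integral_of_le hpp,
    MeasureTheory.setIntegral_congr_fun measurableSet_Ioc h2,
    MeasureTheory.setIntegral_indicator measurableSet_Icc,
    intervalIntegral.integral_of_le (by linarith), ← MeasureTheory.integral_Icc_eq_integral_Ioc]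
  congr 2
  ext ξ
  simp only [Set.mem_inter_iff, Set.mem_Icc, Set.mem_Ioc]
  constructor
  · intro h; refine ⟨⟨by linarith, by linarith⟩, h⟩
  · intro h; exact h.2

lemma arcs_bound {K : ℕ} (κ : Fin K → ℂ) (hκ : ∀ k, ‖κ k‖ = 1) (r : ℝ) (hr : 0 < r)
    (hrpi : r < Real.pi) (hdisj : ∀ k j, k ≠ j → 2 * r < ‖κ k - κ j‖)
    (Φ : ℂ → ℂ) (hΦ : ContinuousOn Φ {z | ‖z‖ = 1}) (Q : ℝ) (hQ : 0 ≤ Q)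
    (hbd : ∀ z, ‖z‖ = 1 → (∀ k, (z / κ k).re < Real.cos r) → ‖Φ z‖ ≤ Q) :
    ‖(∫ θ in (-Real.pi)..Real.pi, Φ (exp (I * θ))) - ∑ k, ∫ ξ in (-r)..r, Φ (κ k * exp (I * ξ))‖
      ≤ 2 * Real.pi * Q := by
  have hn : ∀ θ : ℝ, ‖exp (I * θ)‖ = 1 := fun θ => by rw [mul_comm]; exact norm_exp_ofReal_mul_I θ
  have hc : Continuous fun θ : ℝ => Φ (exp (I * θ)) :=
    hΦ.comp_continuous (by fun_prop) hn
  simp only [arc_one _ (hκ _) r hr hrpi Φ]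
  have hinteg : ∀ k, IntervalIntegrable ({θ : ℝ | Real.cos r ≤ (exp (I * θ) / κ k).re}.indicator
      (fun θ : ℝ => Φ (exp (I * θ)))) MeasureTheory.volume (-Real.pi) Real.pi := by
    intro k
    have hm : MeasurableSet {θ : ℝ | Real.cos r ≤ (exp (I * θ) / κ k).re} := by
      apply IsClosed.measurableSet
      apply isClosed_le continuous_const
      have : Continuous fun θ : ℝ => (exp (I * θ) / κ k) := by fun_prop
      exact continuous_re.comp this
    have := hc.intervalIntegrable (μ := MeasureTheory.volume) (-Real.pi) Real.pi
    exact ⟨this.1.indicator hm, this.2.indicator hm⟩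
  rw [← intervalIntegral.integral_finsetSum (fun k _ => hinteg k),
    ← intervalIntegral.integral_sub (hc.intervalIntegrable _ _)
      (IntervalIntegrable.sum Finset.univ (fun k _ => hinteg k) |>.congr (by intro x hx; simp))]
  have hfin : ∀ θ : ℝ, ‖Φ (exp (I * θ)) - ∑ k,
      {θ : ℝ | Real.cos r ≤ (exp (I * θ) / κ k).re}.indicator (fun θ : ℝ => Φ (exp (I * θ))) θ‖
      ≤ Q := by
    intro θ
    by_cases h : ∃ k, Real.cos r ≤ (exp (I * θ) / κ k).re
    · obtain ⟨k, hk⟩ := h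
      have hclose : ∀ j, Real.cos r ≤ (exp (I * θ) / κ j).re → ‖exp (I * θ) - κ j‖ ≤ r := by
        intro j hj
        have hκ0 : κ j ≠ 0 := by intro h; have := hκ j; simp [h] at this
        have e1 : ‖exp (I * θ) - κ j‖ = ‖exp (I * θ) / κ j - 1‖ := by
          rw [div_sub_one hκ0, norm_div, hκ j, div_one]
        have e0 : ‖exp (I * θ) / κ j‖ = 1 := by rw [norm_div, hn, hκ j, div_one]
        rw [e1]
        set w := exp (I * θ) / κ j
        apply le_of_sq_le_sq _ hr.le
        rw [← normSq_eq_norm_sq] 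
        have e2 : normSq w = 1 := by rw [normSq_eq_norm_sq, e0]; norm_num
        rw [normSq_apply] at e2 ⊢
        simp only [sub_re, one_re, sub_im, one_im]
        have := Real.one_sub_sq_div_two_le_cos (x := r)
        nlinarith
      rw [Finset.sum_eq_single k]
      · rw [Set.indicator_of_mem (by exact hk)]; simpa using hQ
      · intro j _ hj
        rw [Set.indicator_of_notMem]
        intro hj2
        have a1 := hclose j hj2
        have a2 := hclose k hk
        have a3 := hdisj k j (Ne.symm hj)
        have : ‖κ k - κ j‖ ≤ ‖exp (I * θ) - κ j‖ + ‖exp (I * θ) - κ k‖ := by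
          rw [show κ k - κ j = (exp (I * θ) - κ j) - (exp (I * θ) - κ k) by ring]
          exact norm_sub_le _ _
        linarith
      · simp
    · push Not at h
      rw [Finset.sum_eq_zero]
      · simpa using hbd _ (hn θ) h
      · intro k _
        rw [Set.indicator_of_notMem]
        simpa using h k
  have := intervalIntegral.norm_integral_le_of_norm_le_const (a := -Real.pi) (b := Real.pi)
    (fun θ _ => hfin θ)
  refine this.trans (le_of_eq ?_)
  rw [sub_neg_eq_add, abs_of_pos (by linarith [Real.pi_pos])]; ring

lemma re_lower (p : ℕ) (hp : Even p) (β : ℂ) (hβ : 0 < β.re) :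
    ∃ B : ℝ, 0 < B ∧ ∀ s η : ℝ, β.re / 4 * s ^ p - B * η ^ p ≤
      (β * (s + η * I) ^ p).re - β.re / 4 * ‖(s + η * I : ℂ)‖ ^ p := by
  have hc : Continuous fun t : ℝ => (β * (1 + t * I) ^ p).re - β.re / 4 * ‖(1 + t * I : ℂ)‖ ^ p := by
    fun_prop
  have h0 : β.re / 4 < (β * (1 + (0:ℝ) * I) ^ p).re - β.re / 4 * ‖(1 + (0:ℝ) * I : ℂ)‖ ^ p := by
    simp; linarith
  have h1 := hc.continuousAt.eventually (lt_mem_nhds h0)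
  obtain ⟨δ, hδ, h2⟩ := Metric.eventually_nhds_iff.1 h1
  refine ⟨(β.re / 4) * (2 / δ) ^ p + (‖β‖ + β.re / 4) * (2 / δ + 1) ^ p, by positivity, ?_⟩
  intro s η
  have hsp : 0 ≤ s ^ p := hp.pow_nonneg s
  have hηp : 0 ≤ η ^ p := hp.pow_nonneg η
  by_cases hs : s ≠ 0 ∧ |η| < δ * |s|
  · obtain ⟨hs0, hs1⟩ := hs
    have := @h2 (η / s) (by
      rw [Real.dist_eq, sub_zero, abs_div, div_lt_iff₀ (abs_pos.2 hs0)]; exact hs1)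
    have hs0' : (s : ℂ) ≠ 0 := by exact_mod_cast hs0
    have e1 : (s + η * I : ℂ) = s * (1 + (η / s : ℝ) * I) := by
      push_cast; field_simp
    have e2 : (β * (s + η * I) ^ p).re = s ^ p * (β * (1 + (η / s : ℝ) * I) ^ p).re := by
      rw [e1, mul_pow, ← ofReal_pow, mul_left_comm, re_ofReal_mul]
    have e3 : ‖(s + η * I : ℂ)‖ ^ p = s ^ p * ‖(1 + (η / s : ℝ) * I : ℂ)‖ ^ p := by
      rw [e1, norm_mul, mul_pow, norm_real, Real.norm_eq_abs, hp.pow_abs]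
    rw [e2, e3]
    have h3 := mul_le_mul_of_nonneg_left this.le hsp
    have : 0 ≤ ((β.re / 4) * (2 / δ) ^ p + (‖β‖ + β.re / 4) * (2 / δ + 1) ^ p) * η ^ p := by
      positivity
    linarith
  · have hs1 : |s| ≤ (2 / δ) * |η| := by
      by_cases h : s = 0
      · subst h; simp; positivity
      · have : δ * |s| ≤ |η| := by
          by_contra hh; exact hs ⟨h, by linarith⟩
        rw [div_mul_eq_mul_div, le_div_iff₀ hδ]
        nlinarith [abs_nonneg η]
    have hs2 : s ^ p ≤ (2 / δ) ^ p * η ^ p := by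
      rw [← hp.pow_abs s, ← hp.pow_abs η, ← mul_pow]
      exact pow_le_pow_left₀ (abs_nonneg _) hs1 _
    have hξ : ‖(s + η * I : ℂ)‖ ≤ (2 / δ + 1) * |η| := by
      refine (norm_add_le _ _).trans ?_
      simp only [norm_mul, norm_real, norm_I, Real.norm_eq_abs]
      linarith
    have hξ2 : ‖(s + η * I : ℂ)‖ ^ p ≤ (2 / δ + 1) ^ p * η ^ p := by
      rw [← hp.pow_abs η, ← mul_pow]
      exact pow_le_pow_left₀ (norm_nonneg _) hξ _
    have hre : -(‖β‖ * ‖(s + η * I : ℂ)‖ ^ p) ≤ (β * (s + η * I) ^ p).re := by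
      rw [← norm_pow, ← norm_mul]
      exact (abs_le.1 (abs_re_le_norm _)).1
    have h4 := mul_le_mul_of_nonneg_left hξ2 (show 0 ≤ ‖β‖ + β.re / 4 by positivity)
    have h5 := mul_le_mul_of_nonneg_left hs2 (show 0 ≤ β.re / 4 by positivity)
    nlinarith

lemma pow_le_exp (k p : ℕ) (hp : 1 ≤ p) (δ : ℝ) (hδ : 0 < δ) :
    ∃ C : ℝ, 0 < C ∧ ∀ t : ℝ, 0 ≤ t → t ^ k ≤ C * Real.exp (δ * t ^ p) := by
  refine ⟨1 + k.factorial / δ ^ k, by positivity, ?_⟩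
  intro t ht
  have h1 : 1 ≤ Real.exp (δ * t ^ p) := Real.one_le_exp (by positivity)
  rcases le_total t 1 with h | h
  · have : t ^ k ≤ 1 := pow_le_one₀ ht h
    have h2 : (0:ℝ) ≤ k.factorial / δ ^ k := by positivity
    nlinarith
  · have h3 : (δ * t ^ p) ^ k / k.factorial ≤ Real.exp (δ * t ^ p) :=
      Real.pow_div_factorial_le_exp _ (by positivity) _
    have h4 : t ^ k ≤ (t ^ p) ^ k := 
      pow_le_pow_left₀ ht (le_self_pow₀ h (by omega)) _
    have h5 : (t ^ p) ^ k ≤ k.factorial / δ ^ k * Real.exp (δ * t ^ p) := by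
      rw [mul_pow, div_le_iff₀ (by positivity)] at h3
      rw [div_mul_eq_mul_div, le_div_iff₀ (by positivity)]
      linarith
    have := Real.exp_pos (δ * t ^ p)
    nlinarith

lemma integrable_exp_pow (p : ℕ) (hp : Even p) (hp0 : 2 ≤ p) (b : ℝ) (hb : 0 < b) :
    MeasureTheory.Integrable fun t : ℝ => Real.exp (-b * t ^ p) := by
  have h := (integrable_exp_neg_mul_sq hb).const_mul (Real.exp b)
  refine h.mono' (by fun_prop) (Filter.Eventually.of_forall fun t => ?_)
  rw [Real.norm_eq_abs, Real.abs_exp, ← Real.exp_add]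
  apply Real.exp_le_exp.2
  have : t ^ 2 - 1 ≤ t ^ p := by
    rcases le_total |t| 1 with h | h
    · have : t ^ 2 ≤ 1 := by rw [← sq_abs]; exact pow_le_one₀ (abs_nonneg _) h
      linarith [hp.pow_nonneg t]
    · rw [← hp.pow_abs t, ← sq_abs]
      linarith [pow_le_pow_right₀ h hp0]
  nlinarith

/-- scaled integral -/
lemma integral_exp_scaled (p : ℕ) (b : ℝ) (N : ℝ) (hN : 0 < N) :
    ∫ t : ℝ, Real.exp (-b * (N ^ p * t ^ p)) = N⁻¹ * ∫ t : ℝ, Real.exp (-b * t ^ p) := by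
  have := MeasureTheory.Measure.integral_comp_mul_left (fun t : ℝ => Real.exp (-b * t ^ p)) N
  simp only [mul_pow] at this
  rw [this, abs_of_pos (by positivity), smul_eq_mul]

end

section

/-- weight of a multiset -/
noncomputable def msW (c : ℕ → ℂ) (s : Multiset ℕ) : ℂ :=
  ∏ j ∈ s.toFinset, (c j ^ s.count j / ((s.count j).factorial : ℂ))

noncomputable def partW (c : ℕ → ℂ) (m : ℕ) : ℂ := ∑ p : Nat.Partition m, msW c p.parts

/-- the finite set of multisets of positive parts with sum `m` -/
noncomputable def msP (m : ℕ) : Finset (Multiset ℕ) :=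
  (Finset.univ : Finset (Nat.Partition m)).map ⟨Nat.Partition.parts, fun _ _ h => Nat.Partition.ext h⟩

lemma mem_msP (m : ℕ) (s : Multiset ℕ) : s ∈ msP m ↔ (∀ i ∈ s, 0 < i) ∧ s.sum = m := by
  simp only [msP, Finset.mem_map, Finset.mem_univ, true_and]
  constructor
  · rintro ⟨p, rfl⟩
    exact ⟨fun i hi => p.parts_pos hi, p.parts_sum⟩
  · rintro ⟨h1, h2⟩
    exact ⟨⟨s, fun {i} hi => h1 i hi, h2⟩, rfl⟩

lemma partW_eq (c : ℕ → ℂ) (m : ℕ) : partW c m = ∑ s ∈ msP m, msW c s := by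
  simp only [partW, msP, Finset.sum_map]; rfl

lemma msW_eq (c : ℕ → ℂ) (s : Multiset ℕ) (T : Finset ℕ) (h : s.toFinset ⊆ T) :
    msW c s = ∏ j ∈ T, (c j ^ s.count j / ((s.count j).factorial : ℂ)) := by
  rw [msW]
  apply Finset.prod_subset h
  intro j _ hj
  have : s.count j = 0 := Multiset.count_eq_zero.2 (by simpa using hj)
  simp [this]

lemma msW_cons (c : ℕ → ℂ) (j : ℕ) (s : Multiset ℕ) :
    ((j ::ₘ s).count j : ℂ) * msW c (j ::ₘ s) = c j * msW c s := by
  have hT : (j ::ₘ s).toFinset ⊆ insert j s.toFinset := by simp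
  have hT2 : s.toFinset ⊆ insert j s.toFinset := by simp
  have hj : j ∈ insert j s.toFinset := by simp
  rw [msW_eq c _ _ hT, msW_eq c _ _ hT2, ← Finset.mul_prod_erase _ _ hj,
    ← Finset.mul_prod_erase _ _ hj]
  have : ∏ x ∈ (insert j s.toFinset).erase j,
      c x ^ Multiset.count x (j ::ₘ s) / ((Multiset.count x (j ::ₘ s)).factorial : ℂ) =
      ∏ x ∈ (insert j s.toFinset).erase j,
      c x ^ Multiset.count x s / ((Multiset.count x s).factorial : ℂ) := by
    apply Finset.prod_congr rfl
    intro x hx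
    rw [Multiset.count_cons_of_ne (Finset.ne_of_mem_erase hx)]
  rw [this, ← mul_assoc, ← mul_assoc]
  congr 1
  rw [Multiset.count_cons_self, Nat.factorial_succ, pow_succ]
  have : ((s.count j + 1 : ℕ) : ℂ) ≠ 0 := Nat.cast_ne_zero.2 (Nat.succ_ne_zero _)
  have h2 : ((s.count j).factorial : ℂ) ≠ 0 := by exact_mod_cast Nat.factorial_ne_zero _
  push_cast at this ⊢
  field_simp

lemma partW_rec (c : ℕ → ℂ) (m : ℕ) :
    (m : ℂ) * partW c m = ∑ j ∈ Finset.Icc 1 m, (j : ℂ) * c j * partW c (m - j) := by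
  simp only [partW_eq, Finset.mul_sum]
  have h1 : ∀ s ∈ msP m, (m : ℂ) * msW c s =
      ∑ j ∈ s.toFinset, (j : ℂ) * c j * msW c (s.erase j) := by
    intro s hs
    rw [mem_msP] at hs
    have h2 : (m : ℂ) = ∑ j ∈ s.toFinset, (s.count j : ℂ) * j := by
      rw [← hs.2, Finset.sum_multiset_count]; push_cast; simp
    rw [h2, Finset.sum_mul]
    apply Finset.sum_congr rfl
    intro j hj
    have h3 := msW_cons c j (s.erase j)
    rw [Multiset.cons_erase (by simpa using hj)] at h3
    rw [mul_assoc (j : ℂ), ← h3]; ring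
  rw [Finset.sum_congr rfl h1, Finset.sum_sigma', Finset.sum_sigma']
  refine Finset.sum_bij' (fun x _ => ⟨x.2, x.1.erase x.2⟩) (fun x _ => ⟨x.1 ::ₘ x.2, x.1⟩)
    ?_ ?_ ?_ ?_ ?_
  · rintro ⟨s, j⟩ h
    simp only [Finset.mem_sigma, mem_msP, Multiset.mem_toFinset, Finset.mem_Icc] at h ⊢
    obtain ⟨⟨hp, hs⟩, hj⟩ := h
    have h4 : j + (s.erase j).sum = m := by
      rw [← Multiset.sum_cons, Multiset.cons_erase hj, hs]
    exact ⟨⟨hp j hj, by omega⟩, fun i hi => hp i (Multiset.mem_of_mem_erase hi), by omega⟩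
  · rintro ⟨j, s⟩ h
    simp only [Finset.mem_sigma, mem_msP, Multiset.mem_toFinset, Finset.mem_Icc] at h ⊢
    obtain ⟨⟨h1, h2⟩, h3, h4⟩ := h
    refine ⟨⟨?_, by rw [Multiset.sum_cons]; omega⟩, by simp⟩
    intro i hi
    rcases Multiset.mem_cons.1 hi with rfl | hi
    · omega
    · exact h3 i hi
  · rintro ⟨s, j⟩ h
    simp only [Finset.mem_sigma, mem_msP, Multiset.mem_toFinset] at h ⊢
    simp [Multiset.cons_erase h.2]
  · rintro ⟨j, s⟩ h
    simp
  · rintro ⟨s, j⟩ h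
    rfl

lemma partW_zero (c : ℕ → ℂ) : partW c 0 = 1 := by
  rw [partW_eq]
  have : msP 0 = {0} := by
    ext s
    rw [mem_msP, Finset.mem_singleton]
    constructor
    · rintro ⟨h1, h2⟩
      rw [Multiset.sum_eq_zero_iff] at h2
      exact Multiset.eq_zero_of_forall_notMem fun i hi => by
        have := h1 i hi; have := h2 i hi; omega
    · rintro rfl; simp
  rw [this]; simp [msW]

lemma iteratedDeriv_exp_eq (S : ℂ → ℂ) (hS : AnalyticAt ℂ S 0) (hS0 : S 0 = 0) (z : ℂ) (m : ℕ) :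
    iteratedDeriv m (fun ξ => exp (z * S ξ)) 0 =
      m.factorial * partW (fun j => z * (iteratedDeriv j S 0 / j.factorial)) m := by
  induction m using Nat.strong_induction_on with
  | _ m ih =>
  rcases m with _ | m
  · simp [partW_zero, hS0]
  have hG : AnalyticAt ℂ (fun ξ => exp (z * S ξ)) 0 := by fun_prop
  have hd : deriv (fun ξ => exp (z * S ξ)) =ᶠ[nhds 0]
      fun ξ => (z * deriv S ξ) * exp (z * S ξ) := by
    filter_upwards [hS.eventually_analyticAt] with ξ hξ
    have h1 := ((hξ.differentiableAt.hasDerivAt.const_mul z).cexp).deriv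
    rw [h1]; ring
  have hS' : AnalyticAt ℂ (fun ξ => z * deriv S ξ) 0 := analyticAt_const.mul hS.deriv
  rw [iteratedDeriv_succ', hd.iteratedDeriv_eq, iteratedDeriv_fun_mul hS'.contDiffAt hG.contDiffAt]
  have hr := partW_rec (fun j => z * (iteratedDeriv j S 0 / j.factorial)) (m + 1)
  rw [Nat.factorial_succ, mul_comm (m+1)]
  have hsh := Finset.sum_Ico_add' (fun x : ℕ => (m.factorial : ℂ) *
    ((x : ℂ) * (z * (iteratedDeriv x S 0 / x.factorial)) *
      partW (fun j => z * (iteratedDeriv j S 0 / j.factorial)) (m + 1 - x))) 0 (m + 1) 1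
  rw [Nat.cast_mul, mul_assoc, hr, Finset.mul_sum, Finset.range_eq_Ico,
    ← Finset.Ico_add_one_right_eq_Icc]
  refine Eq.trans ?_ hsh
  apply Finset.sum_congr rfl
  intro i hi
  have hi' : i ≤ m := by simp at hi; omega
  rw [ih (m - i) (by omega), show m + 1 - (i + 1) = m - i by omega,
    iteratedDeriv_const_mul_field, ← iteratedDeriv_succ', Nat.factorial_succ]
  have e1 : (m.choose i : ℂ) * i.factorial * (m - i).factorial = m.factorial := by
    exact_mod_cast Nat.choose_mul_factorial_mul_factorial hi'
  rw [← e1]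
  have : ((i : ℂ) + 1) ≠ 0 := Nat.cast_add_one_ne_zero i
  have h2 : (i.factorial : ℂ) ≠ 0 := by exact_mod_cast Nat.factorial_ne_zero _
  push_cast
  field_simp

lemma taylor_bound (G : ℂ → ℂ) (r : ℝ) (hr : 0 < r) (hG : DifferentiableOn ℂ G (Metric.ball 0 (2 * r)))
    (A : ℝ) (hA : ∀ ξ, ‖ξ‖ ≤ r → ‖G ξ‖ ≤ A) (M : ℕ) (ξ : ℂ) (hξ : ‖ξ‖ ≤ r / 2) :
    ‖G ξ - ∑ m ∈ Finset.range (M + 1), iteratedDeriv m G 0 / m.factorial * ξ ^ m‖ ≤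
      2 * A * (‖ξ‖ / r) ^ (M + 1) := by
  have hA0 : 0 ≤ A := (norm_nonneg _).trans (hA 0 (by simpa using hr.le))
  have h1 := Complex.hasSum_taylorSeries_on_ball hG (z := ξ) (by simp; linarith)
  have h2 := (hasSum_nat_add_iff' (M + 1)).2 h1
  have hd : DiffContOnCl ℂ G (Metric.ball 0 r) := by
    apply DifferentiableOn.diffContOnCl
    apply hG.mono
    refine Metric.closure_ball_subset_closedBall.trans ?_
    apply Metric.closedBall_subset_ball; linarith
  have h3 : ∀ m, ‖iteratedDeriv m G 0‖ ≤ m.factorial * A / r ^ m := fun m =>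
    Complex.norm_iteratedDeriv_le_of_forall_mem_sphere_norm_le m hr hd
      (fun z hz => hA z (by simp at hz; exact hz.le))
  set q := ‖ξ‖ / r with hq
  have hq0 : 0 ≤ q := by positivity
  have hq1 : q ≤ 1 / 2 := by rw [hq, div_le_iff₀ hr]; linarith
  have hg : HasSum (fun m : ℕ => A * q ^ (M + 1) * q ^ m) (A * q ^ (M + 1) * (1 - q)⁻¹) :=
    (hasSum_geometric_of_lt_one hq0 (by linarith)).mul_left _
  have h4 := h2.norm_le_of_bounded hg (fun m => by
    simp only [smul_eq_mul, norm_mul, norm_inv, norm_pow, sub_zero, norm_natCast]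
    have := h3 (m + (M + 1))
    have hf : (0:ℝ) < (m + (M + 1)).factorial := by exact_mod_cast Nat.factorial_pos _
    calc _ ≤ ((m + (M + 1)).factorial : ℝ)⁻¹ * (‖ξ‖ ^ (m + (M + 1)) *
          ((m + (M + 1)).factorial * A / r ^ (m + (M + 1)))) := by gcongr
      _ = A * q ^ (m + (M + 1)) := by rw [hq, div_pow]; field_simp
      _ = _ := by rw [pow_add]; ring
      _ ≤ _ := le_rfl)
  have e : G ξ - ∑ m ∈ Finset.range (M + 1), iteratedDeriv m G 0 / m.factorial * ξ ^ m =
     G ξ - ∑ i ∈ Finset.range (M + 1), ((i.factorial : ℂ))⁻¹ • (ξ - 0) ^ i • iteratedDeriv i G 0 := by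
    congr 1
    apply Finset.sum_congr rfl
    intro i _
    simp only [smul_eq_mul, sub_zero]; field_simp
  rw [e]
  refine h4.trans ?_
  have : (1 - q)⁻¹ ≤ 2 := by
    rw [inv_le_comm₀ (by linarith) (by norm_num)]; linarith
  calc A * q ^ (M + 1) * (1 - q)⁻¹ ≤ A * q ^ (M + 1) * 2 := by gcongr
    _ = _ := by ring

lemma taylor_main (S : ℂ → ℂ) (hS : AnalyticAt ℂ S 0) (hS0 : S 0 = 0) (δ : ℝ) (hδ : 0 < δ) :
    ∃ r : ℝ, 0 < r ∧ DifferentiableOn ℂ S (Metric.ball 0 r) ∧ ∀ M : ℕ, ∃ C : ℝ, 0 < C ∧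
      ∀ z ξ : ℂ, ‖ξ‖ < r → ‖exp (z * S ξ) - ∑ m ∈ Finset.range (M + 1),
        partW (fun j => z * (iteratedDeriv j S 0 / j.factorial)) m * ξ ^ m‖ ≤
        C * ‖ξ‖ ^ (M + 1) * Real.exp (δ * ‖z‖) := by
  have h1 := hS.eventually_analyticAt
  have h2 : ∀ᶠ ξ in nhds 0, ‖S ξ‖ < δ := by
    have := hS.continuousAt.norm.eventually (gt_mem_nhds (show ‖S 0‖ < δ by simpa [hS0] using hδ))
    exact this
  obtain ⟨R, hR, h3⟩ := Metric.eventually_nhds_iff.1 (h1.and h2)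
  have hd : DifferentiableOn ℂ S (Metric.ball 0 R) := fun ξ hξ =>
    (h3 hξ).1.differentiableAt.differentiableWithinAt
  refine ⟨R / 4, by positivity, hd.mono (Metric.ball_subset_ball (by linarith)), fun M => ?_⟩
  refine ⟨2 * (1 / (R / 2)) ^ (M + 1), by positivity, fun z ξ hξ => ?_⟩
  have h4 := taylor_bound (fun ξ => exp (z * S ξ)) (R / 2) (by positivity)
    (by
      rw [show 2 * (R / 2) = R by ring]
      exact (hd.const_mul z).cexp) (Real.exp (δ * ‖z‖)) (by
      intro w hw
      rw [norm_exp]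
      apply Real.exp_le_exp.2
      refine (re_le_norm _).trans ?_
      rw [norm_mul, mul_comm]
      gcongr
      exact (h3 (by simp; linarith)).2.le) M ξ (by linarith)
  simp only [iteratedDeriv_exp_eq S hS hS0] at h4
  have e : ∀ m : ℕ, (m.factorial : ℂ) * partW (fun j => z * (iteratedDeriv j S 0 / j.factorial)) m /
      m.factorial = partW (fun j => z * (iteratedDeriv j S 0 / j.factorial)) m := fun m => by
    have h2 : (m.factorial : ℂ) ≠ 0 := by exact_mod_cast Nat.factorial_ne_zero _
    field_simp
  simp only [e] at h4
  refine h4.trans (le_of_eq ?_)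
  rw [div_eq_mul_one_div ‖ξ‖, mul_pow]; ring

end

section
open MeasureTheory

lemma norm_gauss (μ : ℕ) (β : ℂ) (x θ : ℝ) :
    ‖exp (-I * x * θ) * exp (-β * (θ : ℂ) ^ (2 * μ))‖ = Real.exp (-β.re * θ ^ (2 * μ)) := by
  rw [norm_mul, norm_exp, norm_exp, ← ofReal_pow, show (-I * x * θ : ℂ).re = 0 by simp,
    re_mul_ofReal, Real.exp_zero, one_mul, neg_re]

lemma integrable_pow_gauss (μ : ℕ) (hμ : 1 ≤ μ) (b : ℝ) (hb : 0 < b) (j : ℕ) :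
    Integrable fun θ : ℝ => |θ| ^ j * Real.exp (-b * θ ^ (2 * μ)) := by
  obtain ⟨C, hC, h⟩ := pow_le_exp j (2 * μ) (by omega) (b / 2) (by positivity)
  refine ((integrable_exp_pow (2 * μ) (even_two_mul μ) (by omega) (b / 2) (by positivity)).const_mul C).mono'
    (by fun_prop) (Filter.Eventually.of_forall fun t => ?_)
  rw [Real.norm_eq_abs, abs_of_nonneg (by positivity)]
  calc |t| ^ j * Real.exp (-b * t ^ (2 * μ)) ≤
      (C * Real.exp (b / 2 * |t| ^ (2 * μ))) * Real.exp (-b * t ^ (2 * μ)) := by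
        gcongr; exact h _ (abs_nonneg _)
    _ = C * Real.exp (-(b / 2) * t ^ (2 * μ)) := by
        rw [(even_two_mul μ).pow_abs, mul_assoc, ← Real.exp_add]; ring_nf

lemma integrable_dgauss (μ : ℕ) (hμ : 1 ≤ μ) (β : ℂ) (hβ : 0 < β.re) (j : ℕ) (x : ℝ) :
    Integrable fun θ : ℝ => (-I * θ) ^ j * (exp (-I * x * θ) * exp (-β * (θ : ℂ) ^ (2 * μ))) := by
  refine (integrable_pow_gauss μ hμ β.re hβ j).mono' (by fun_prop)
    (Filter.Eventually.of_forall fun t => ?_)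
  rw [norm_mul, norm_gauss]
  simp

lemma iteratedDeriv_Hfun (μ : ℕ) (hμ : 1 ≤ μ) (β : ℂ) (hβ : 0 < β.re) (j : ℕ) :
    iteratedDeriv j (Hfun μ β) = fun x : ℝ => (1 / (2 * Real.pi : ℂ)) *
      ∫ θ : ℝ, (-I * θ) ^ j * (exp (-I * x * θ) * exp (-β * (θ : ℂ) ^ (2 * μ))) := by
  induction j with
  | zero => ext x; simp [Hfun]
  | succ j ih =>
    rw [iteratedDeriv_succ, ih]
    ext x
    have h := hasDerivAt_integral_of_dominated_loc_of_deriv_le (μ := volume) (𝕜 := ℝ)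
      (F := fun (x : ℝ) (θ : ℝ) => (-I * θ) ^ j * (exp (-I * x * θ) * exp (-β * (θ : ℂ) ^ (2 * μ))))
      (F' := fun (x : ℝ) (θ : ℝ) => (-I * θ) ^ (j + 1) * (exp (-I * x * θ) * exp (-β * (θ : ℂ) ^ (2 * μ))))
      (x₀ := x) (s := Set.univ) (bound := fun θ => |θ| ^ (j + 1) * Real.exp (-β.re * θ ^ (2 * μ)))
      Filter.univ_mem (Filter.Eventually.of_forall fun x => (integrable_dgauss μ hμ β hβ j x).1)
      (integrable_dgauss μ hμ β hβ j x) (integrable_dgauss μ hμ β hβ (j+1) x).1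
      (Filter.Eventually.of_forall fun θ x _ => by
        rw [norm_mul, norm_gauss]; simp)
      (integrable_pow_gauss μ hμ β.re hβ (j + 1))
      (Filter.Eventually.of_forall fun θ x _ => by
        have h1 : HasDerivAt (fun x : ℝ => (x : ℂ)) 1 x := Complex.ofRealCLM.hasDerivAt
        have h2 := ((((h1.const_mul (-I)).mul_const (θ : ℂ)).cexp).mul_const
          (exp (-β * (θ : ℂ) ^ (2 * μ)))).const_mul ((-I * θ) ^ j)
        refine h2.congr_deriv ?_
        ring)
    exact (h.2.const_mul _).deriv

lemma Hfun_scaled (μ : ℕ) (hμ : 1 ≤ μ) (β : ℂ) (hβ : 0 < β.re) (d : ℕ) (N : ℝ) (hN : 0 < N) (y : ℝ) :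
    (N : ℂ)⁻¹ * ((-1) ^ d * iteratedDeriv d (Hfun μ β) (y / N)) = (1 / (2 * Real.pi : ℂ)) *
      ∫ ξ : ℝ, (I * (N * ξ)) ^ d * (exp (-I * y * ξ) * exp (-β * ((N : ℂ) ^ (2 * μ) * ξ ^ (2 * μ)))) := by
  rw [iteratedDeriv_Hfun μ hμ β hβ]
  have h := Measure.integral_comp_mul_left (fun θ : ℝ =>
    (-I * θ) ^ d * (exp (-I * (y / N : ℝ) * θ) * exp (-β * (θ : ℂ) ^ (2 * μ)))) N
  rw [abs_of_pos (by positivity), real_smul] at h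
  have hN' : (N : ℂ) ≠ 0 := by exact_mod_cast hN.ne'
  calc _ = (1 / (2 * Real.pi : ℂ)) * ((-1) ^ d * (((N⁻¹ : ℝ) : ℂ) * ∫ θ : ℝ, 
    (-I * θ) ^ d * (exp (-I * (y / N : ℝ) * θ) * exp (-β * (θ : ℂ) ^ (2 * μ))))) := by
        push_cast; ring
    _ = _ := by
      rw [← h, ← integral_const_mul]
      congr 2
      ext ξ
      push_cast
      rw [← mul_assoc, ← mul_pow]
      congr 2
      · ring
      · congr 1
        field_simp
      · rw [mul_pow]

lemma integrable_scaled (μ : ℕ) (hμ : 1 ≤ μ) (β : ℂ) (hβ : 0 < β.re) (d : ℕ) (N : ℝ) (hN : 0 < N)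
    (y : ℝ) : Integrable fun ξ : ℝ =>
      (I * (N * ξ)) ^ d * (exp (-I * y * ξ) * exp (-β * ((N : ℂ) ^ (2 * μ) * ξ ^ (2 * μ)))) := by
  have h := ((integrable_dgauss μ hμ β hβ d (y / N)).comp_mul_left' hN.ne').const_mul ((-1) ^ d)
  refine h.congr (Filter.Eventually.of_forall fun ξ => ?_)
  have hN' : (N : ℂ) ≠ 0 := by exact_mod_cast hN.ne'
  simp only
  push_cast
  rw [← mul_assoc, ← mul_pow]
  congr 2
  · ring
  · congr 1
    field_simp
  · rw [mul_pow]

lemma msW_scale (u v : ℂ) (g : ℕ → ℂ) (s : Multiset ℕ) :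
    msW (fun j => u * (v ^ j * g j)) s = u ^ (Multiset.card s) * v ^ s.sum * msW g s := by
  unfold msW
  simp only [mul_pow, mul_div_assoc, Finset.prod_mul_distrib]
  rw [Finset.prod_pow_eq_pow_sum, Multiset.toFinset_sum_count_eq]
  have : ∏ x ∈ s.toFinset, (v ^ x) ^ s.count x = v ^ s.sum := by
    simp only [← pow_mul]
    rw [Finset.prod_pow_eq_pow_sum, Finset.sum_multiset_count s]
    congr 1
    apply Finset.sum_congr rfl
    intro x _
    rw [smul_eq_mul, mul_comm]
  rw [this, mul_assoc]

/-- normalized coefficients -/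
noncomputable def gco (μ : ℕ) (γ : ℕ → ℂ) (j : ℕ) : ℂ :=
  γ (2 * μ + j) / (Nat.factorial (2 * μ + j) : ℂ)

lemma PdiffH_eq (μ : ℕ) (γ : ℕ → ℂ) (m : ℕ) (H : ℝ → ℂ) (x : ℝ) :
    PdiffH μ γ m H x = ∑ p : Nat.Partition m, msW (gco μ γ) p.parts *
      ((-1) ^ (m + 2 * μ * Multiset.card p.parts) *
      iteratedDeriv (m + 2 * μ * Multiset.card p.parts) H x) := by
  unfold PdiffH
  apply Finset.sum_congr rfl
  intro p _
  simp only [msW, gco, Finset.prod_div_distrib]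
  ring

/-- the polynomial approximation -/
noncomputable def Tfun (μ : ℕ) (γ : ℕ → ℂ) (M : ℕ) (N : ℝ) (ξ : ℂ) : ℂ :=
  ∑ m ∈ Finset.range (M + 1), partW (fun j => ((N : ℂ) ^ (2 * μ) * ξ ^ (2 * μ)) *
    (I ^ (2 * μ + j) * gco μ γ j)) m * ξ ^ m

lemma Tfun_eq (μ : ℕ) (γ : ℕ → ℂ) (M : ℕ) (N : ℝ) (hN : 0 < N) (ξ : ℂ) :
    Tfun μ γ M N ξ = ∑ m ∈ Finset.range (M + 1), ∑ p : Nat.Partition m,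
      ((N : ℂ) ^ m)⁻¹ * msW (gco μ γ) p.parts *
        (I * (N * ξ)) ^ (m + 2 * μ * Multiset.card p.parts) := by
  have hN' : (N : ℂ) ≠ 0 := by exact_mod_cast hN.ne'
  unfold Tfun partW
  apply Finset.sum_congr rfl
  intro m _
  rw [Finset.sum_mul]
  apply Finset.sum_congr rfl
  intro p _
  have : (fun j => ((N : ℂ) ^ (2 * μ) * ξ ^ (2 * μ)) * (I ^ (2 * μ + j) * gco μ γ j)) =
      fun j => (I * (N * ξ)) ^ (2 * μ) * (I ^ j * gco μ γ j) := by
    ext j; rw [pow_add, mul_pow, mul_pow]; ring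
  rw [this, msW_scale, p.parts_sum, pow_add _ m, ← pow_mul]
  have h3 : (I * (N * ξ)) ^ m = (N : ℂ) ^ m * (I ^ m * ξ ^ m) := by
    rw [mul_pow, mul_pow]; ring
  rw [h3]
  field_simp

lemma Tfun_int (μ : ℕ) (hμ : 1 ≤ μ) (β : ℂ) (hβ : 0 < β.re) (γ : ℕ → ℂ) (M : ℕ) (N : ℝ)
    (hN : 0 < N) (y : ℝ) :
    (Integrable fun ξ : ℝ => Tfun μ γ M N ξ * 
      (exp (-I * y * ξ) * exp (-β * ((N : ℂ) ^ (2 * μ) * ξ ^ (2 * μ))))) ∧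
    ∑ m ∈ Finset.range (M + 1), ((N : ℂ) ^ (m + 1))⁻¹ * PdiffH μ γ m (Hfun μ β) (y / N) =
      (1 / (2 * Real.pi : ℂ)) * ∫ ξ : ℝ, Tfun μ γ M N ξ * 
      (exp (-I * y * ξ) * exp (-β * ((N : ℂ) ^ (2 * μ) * ξ ^ (2 * μ)))) := by
  have hi : ∀ m : ℕ, ∀ p : Nat.Partition m, Integrable fun ξ : ℝ =>
      ((N : ℂ) ^ m)⁻¹ * msW (gco μ γ) p.parts * ((I * (N * ξ)) ^ (m + 2 * μ * Multiset.card p.parts) *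
      (exp (-I * y * ξ) * exp (-β * ((N : ℂ) ^ (2 * μ) * ξ ^ (2 * μ))))) := fun m p =>
    (integrable_scaled μ hμ β hβ _ N hN y).const_mul _
  have he : (fun ξ : ℝ => Tfun μ γ M N ξ * 
      (exp (-I * y * ξ) * exp (-β * ((N : ℂ) ^ (2 * μ) * ξ ^ (2 * μ))))) = fun ξ : ℝ =>
      ∑ m ∈ Finset.range (M + 1), ∑ p : Nat.Partition m,
      ((N : ℂ) ^ m)⁻¹ * msW (gco μ γ) p.parts * ((I * (N * ξ)) ^ (m + 2 * μ * Multiset.card p.parts) *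
      (exp (-I * y * ξ) * exp (-β * ((N : ℂ) ^ (2 * μ) * ξ ^ (2 * μ))))) := by
    ext ξ
    rw [Tfun_eq _ _ _ _ hN]
    simp only [Finset.sum_mul, mul_assoc]
  constructor
  · rw [he]
    exact integrable_finsetSum _ fun m _ => integrable_finsetSum _ fun p _ => hi m p
  · rw [he, integral_finsetSum _ fun m _ => integrable_finsetSum _ fun p _ => hi m p,
      Finset.mul_sum]
    apply Finset.sum_congr rfl
    intro m _
    rw [integral_finsetSum _ fun p _ => hi m p, Finset.mul_sum, PdiffH_eq, Finset.mul_sum]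
    apply Finset.sum_congr rfl
    intro p _
    rw [integral_const_mul, mul_left_comm (1 / (2 * Real.pi : ℂ)), ← Hfun_scaled μ hμ β hβ _ N hN]
    rw [pow_succ, mul_inv]; ring

lemma Tfun_bound (μ : ℕ) (hμ : 1 ≤ μ) (γ : ℕ → ℂ) (M : ℕ) (δ : ℝ) (hδ : 0 < δ) :
    ∃ C : ℝ, 0 < C ∧ ∀ N : ℝ, 1 ≤ N → ∀ ξ : ℝ,
      ‖Tfun μ γ M N ξ‖ ≤ C * Real.exp (δ * (N ^ (2 * μ) * ξ ^ (2 * μ))) := by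
  choose C hC h using fun d => pow_le_exp d (2 * μ) (by omega) δ hδ
  refine ⟨1 + ∑ m ∈ Finset.range (M + 1), ∑ p : Nat.Partition m,
    ‖msW (gco μ γ) p.parts‖ * C (m + 2 * μ * Multiset.card p.parts), ?_, ?_⟩
  · have : 0 ≤ ∑ m ∈ Finset.range (M + 1), ∑ p : Nat.Partition m,
      ‖msW (gco μ γ) p.parts‖ * C (m + 2 * μ * Multiset.card p.parts) :=
      Finset.sum_nonneg fun m _ => Finset.sum_nonneg fun p _ => 
        mul_nonneg (norm_nonneg _) (hC _).le
    linarith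
  intro N hN ξ
  have hN0 : 0 < N := by linarith
  rw [Tfun_eq _ _ _ _ hN0, add_mul, Finset.sum_mul]
  refine le_add_of_nonneg_of_le (by positivity) ?_
  refine norm_sum_le_of_le _ fun m _ => ?_
  rw [Finset.sum_mul]
  refine norm_sum_le_of_le _ fun p _ => ?_
  rw [norm_mul, norm_mul, norm_inv, norm_pow, norm_pow, norm_mul, norm_I, one_mul, ← ofReal_mul,
    norm_real, norm_real, Real.norm_eq_abs, Real.norm_eq_abs, abs_of_pos hN0]
  have h1 := h (m + 2 * μ * Multiset.card p.parts) |N * ξ| (abs_nonneg _)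
  rw [(even_two_mul μ).pow_abs, mul_pow] at h1
  have h2 : (N ^ m)⁻¹ ≤ 1 := inv_le_one_of_one_le₀ (one_le_pow₀ hN)
  calc _ ≤ 1 * ‖msW (gco μ γ) p.parts‖ * (C (m + 2 * μ * Multiset.card p.parts) *
        Real.exp (δ * (N ^ (2 * μ) * ξ ^ (2 * μ)))) := by gcongr
    _ = _ := by ring

end

section
open MeasureTheory

lemma contour_bound (p : ℕ) (hp : Even p) (hp2 : 2 ≤ p) (g : ℂ → ℂ) (R r A b B N w W y τ : ℝ)
    (hr : 0 < r) (hrR : 2 * r < R) (hg : DifferentiableOn ℂ g (Metric.ball 0 R))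
    (hA : 0 ≤ A) (hb : 0 < b) (hB : 0 ≤ B) (hN : 1 ≤ N) (hw : 0 ≤ w)
    (hwW : w ≤ W * N) (hy : |y| = N * w ^ (p - 1)) (hτ : 0 < τ) (hτ1 : B * τ ^ (p - 1) ≤ 1 / 2)
    (hτ2 : τ * W ≤ r) (hτ3 : B * (τ * W) ^ p ≤ b / 2 * r ^ p)
    (hbd : ∀ s η : ℝ, ‖(s + η * I : ℂ)‖ < R → ‖g (s + η * I)‖ ≤
      A * Real.exp (y * η - N ^ p * (b * s ^ p - B * η ^ p))) :
    ‖∫ ξ in (-r)..r, g ξ‖ ≤ A * (N⁻¹ * ∫ t : ℝ, Real.exp (-b * t ^ p)) * Real.exp (-(τ / 2) * w ^ p)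
      + 2 * (A * r) * Real.exp (-(b / 2 * r ^ p) * N ^ p) := by
  have hN0 : 0 < N := by linarith
  obtain ⟨η0, h1, h2⟩ : ∃ η0 : ℝ, |η0| = τ * w / N ∧ y * η0 = -(|y| * |η0|) := by
    have h0 : 0 ≤ τ * w / N := by positivity
    rcases le_total 0 y with h | h
    · refine ⟨-(τ * w / N), by rw [abs_neg, abs_of_nonneg h0], ?_⟩
      rw [abs_neg, abs_of_nonneg h0, abs_of_nonneg h]; ring
    · refine ⟨(τ * w / N), by rw [abs_of_nonneg h0], ?_⟩
      rw [abs_of_nonneg h0, abs_of_nonpos h]; ring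
  have hη0 : |η0| ≤ τ * W := by
    rw [h1, div_le_iff₀ hN0, mul_assoc]; gcongr
  have hyη : y * η0 = -(τ * w ^ p) := by
    rw [h2, h1, hy]
    obtain ⟨q, rfl⟩ : ∃ q, p = q + 1 := ⟨p - 1, by omega⟩
    simp only [Nat.add_sub_cancel]
    rw [pow_succ]
    field_simp
  have hNη : N ^ p * η0 ^ p = τ ^ p * w ^ p := by
    rw [← hp.pow_abs η0, h1, ← mul_pow, ← mul_pow]; congr 1; field_simp
  -- points of the rectangle
  have hrect : ∀ s η : ℝ, |s| ≤ r → |η| ≤ |η0| → ‖(s + η * I : ℂ)‖ < R := by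
    intro s η hs hη
    refine (norm_add_le _ _).trans_lt ?_
    simp only [norm_mul, norm_real, norm_I, Real.norm_eq_abs]
    linarith
  have hmem : ∀ η ∈ Set.uIcc 0 η0, |η| ≤ |η0| ∧ y * η ≤ 0 := by
    intro η hη
    have hy0 : y * η0 ≤ 0 := by rw [h2]; have := abs_nonneg y; have := abs_nonneg η0; nlinarith
    rcases le_total 0 η0 with h | h
    · rw [Set.uIcc_of_le h] at hη
      rw [abs_of_nonneg h, abs_of_nonneg hη.1]
      refine ⟨hη.2, ?_⟩
      rcases h.eq_or_lt with h' | h'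
      · have : η = 0 := le_antisymm (h' ▸ hη.2) hη.1
        simp [this]
      · have : y ≤ 0 := by by_contra hh; push Not at hh; nlinarith
        nlinarith [hη.1]
    · rw [Set.uIcc_of_ge h] at hη
      rw [abs_of_nonpos h, abs_of_nonpos hη.2]
      refine ⟨by linarith [hη.1], ?_⟩
      rcases h.eq_or_lt with h' | h'
      · have : η = 0 := le_antisymm hη.2 (h' ▸ hη.1)
        simp [this]
      · have : 0 ≤ y := by by_contra hh; push Not at hh; nlinarith
        nlinarith [hη.2]
  have hC := Complex.integral_boundary_rect_eq_zero_of_differentiableOn g (-(r : ℂ)) (r + η0 * I) (by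
    apply hg.mono
    intro z hz
    rw [Complex.mem_reProdIm] at hz
    simp at hz
    have := hrect z.re z.im (by
      rw [Set.uIcc_of_le (by linarith)] at hz; exact abs_le.2 hz.1) (hmem _ hz.2).1
    rw [re_add_im] at this
    simpa using this)
  simp only [neg_re, ofReal_re, add_re, mul_re, I_re, mul_zero, ofReal_im, I_im, mul_one, sub_self,
    add_zero, neg_im, neg_zero, ofReal_zero, zero_mul, add_im, mul_im, zero_add] at hC
  -- top
  have htop : ‖∫ x in (-r)..r, g (x + η0 * I)‖ ≤
      A * (N⁻¹ * ∫ t : ℝ, Real.exp (-b * t ^ p)) * Real.exp (-(τ / 2) * w ^ p) := by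
    have hinteg0 := (integrable_exp_pow p hp hp2 b hb).comp_mul_left' hN0.ne'
    simp only [mul_pow] at hinteg0
    have e1 : ∀ x ∈ Set.Ioc (-r) r, ‖g (x + η0 * I)‖ ≤
        A * Real.exp (-(τ / 2) * w ^ p) * Real.exp (-b * (N ^ p * x ^ p)) := by
      intro x hx
      refine (hbd x η0 (hrect x η0 (abs_le.2 ⟨hx.1.le, hx.2⟩) le_rfl)).trans ?_
      rw [mul_assoc, ← Real.exp_add]
      apply mul_le_mul_of_nonneg_left _ hA
      apply Real.exp_le_exp.2
      have : B * (N ^ p * η0 ^ p) ≤ τ / 2 * w ^ p := by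
        rw [hNη]
        obtain ⟨q, rfl⟩ : ∃ q, p = q + 1 := ⟨p - 1, by omega⟩
        simp only [Nat.add_sub_cancel] at hτ1
        rw [pow_succ τ]
        have h3 : 0 ≤ τ * w ^ (q + 1) := by positivity
        nlinarith
      rw [hyη]
      nlinarith
    have hinteg := hinteg0.const_mul (A * Real.exp (-(τ / 2) * w ^ p))
    calc _ ≤ ∫ x in (-r)..r, A * Real.exp (-(τ / 2) * w ^ p) * Real.exp (-b * (N ^ p * x ^ p)) :=
          intervalIntegral.norm_integral_le_of_norm_le (by linarith)
            (Filter.Eventually.of_forall e1) hinteg.intervalIntegrable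
      _ ≤ ∫ x : ℝ, A * Real.exp (-(τ / 2) * w ^ p) * Real.exp (-b * (N ^ p * x ^ p)) := by
          rw [intervalIntegral.integral_of_le (by linarith)]
          exact setIntegral_le_integral hinteg (Filter.Eventually.of_forall fun x => by
            simp only [Pi.zero_apply]; positivity)
      _ = _ := by rw [integral_const_mul, integral_exp_scaled p b N hN0]; ring
  have hside : ∀ s : ℝ, |s| = r → ‖∫ η in (0:ℝ)..η0, g (s + η * I)‖ ≤
      (A * r) * Real.exp (-(b / 2 * r ^ p) * N ^ p) := by
    intro s hs
    have e1 : ∀ η ∈ Set.uIoc 0 η0, ‖g (s + η * I)‖ ≤ A * Real.exp (-(b / 2 * r ^ p) * N ^ p) := by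
      intro η hη
      have h3 := hmem η (Set.uIoc_subset_uIcc hη)
      refine (hbd s η (hrect s η hs.le h3.1)).trans ?_
      apply mul_le_mul_of_nonneg_left _ hA
      apply Real.exp_le_exp.2
      have h4 : η ^ p ≤ (τ * W) ^ p := by
        rw [← hp.pow_abs]; exact pow_le_pow_left₀ (abs_nonneg _) (h3.1.trans hη0) _
      have h5 : s ^ p = r ^ p := by rw [← hp.pow_abs, hs]
      have h6 : B * η ^ p ≤ b / 2 * r ^ p := (mul_le_mul_of_nonneg_left h4 hB).trans hτ3
      have h7 : 0 < N ^ p := by positivity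
      rw [h5]
      nlinarith [h3.2]
    have := intervalIntegral.norm_integral_le_of_norm_le_const e1
    refine this.trans ?_
    rw [sub_zero, mul_right_comm]
    gcongr
    exact hη0.trans hτ2
  have hs1 := hside r (abs_of_pos hr)
  have hs2 := hside (-r) (by rw [abs_neg, abs_of_pos hr])
  have e : (∫ ξ in (-r)..r, g ξ) = (∫ x in (-r)..r, g (x + η0 * I))
      - I • (∫ η in (0:ℝ)..η0, g (r + η * I)) + I • (∫ η in (0:ℝ)..η0, g ((-r : ℝ) + η * I)) := by
    linear_combination hC
  rw [e]
  refine (norm_add_le _ _).trans ?_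
  have := norm_sub_le (∫ x in (-r)..r, g (x + η0 * I)) (I • (∫ η in (0:ℝ)..η0, g (r + η * I)))
  rw [norm_smul, norm_I, one_mul] at this ⊢
  linarith

lemma absorb (k p : ℕ) (hp : 1 ≤ p) (κ W : ℝ) (hκ : 0 < κ) (hW : 1 ≤ W) :
    ∃ C : ℝ, 0 < C ∧ ∀ N w : ℝ, 1 ≤ N → 0 ≤ w → w ≤ W * N →
      Real.exp (-κ * N ^ p) ≤ C * ((N ^ k)⁻¹ * Real.exp (-(κ / (2 * W ^ p)) * w ^ p)) := by
  obtain ⟨C, hC, h⟩ := pow_le_exp k p hp (κ / 2) (by positivity)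
  refine ⟨C, hC, fun N w hN hw hwW => ?_⟩
  have hN0 : 0 < N := by linarith
  have h1 := h N hN0.le
  have h2 : Real.exp (-(κ / 2) * N ^ p) ≤ Real.exp (-(κ / (2 * W ^ p)) * w ^ p) := by
    apply Real.exp_le_exp.2
    have h3 : w ^ p ≤ W ^ p * N ^ p := by rw [← mul_pow]; gcongr
    have h4 : κ / (2 * W ^ p) * w ^ p ≤ κ / (2 * W ^ p) * (W ^ p * N ^ p) := by gcongr
    have h5 : κ / (2 * W ^ p) * (W ^ p * N ^ p) = κ / 2 * N ^ p := by field_simp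
    linarith
  have e : Real.exp (-κ * N ^ p) = Real.exp (-(κ / 2) * N ^ p) * Real.exp (-(κ / 2) * N ^ p) := by
    rw [← Real.exp_add]; ring_nf
  have h6 : Real.exp (-(κ / 2) * N ^ p) ≤ C * (N ^ k)⁻¹ := by
    rw [neg_mul, Real.exp_neg, ← div_eq_mul_inv, le_div_iff₀ (by positivity), inv_mul_le_iff₀ (Real.exp_pos _)]
    linarith
  rw [e, ← mul_assoc]
  gcongr

lemma exists_S (μ : ℕ) (γ : ℕ → ℂ) (hγlow : ∀ ν : ℕ, ν < 2 * μ + 1 → γ ν = 0) (ρ : ℝ) (hρ : 0 < ρ)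
    (hexp : ∀ ξ : ℂ, ‖ξ‖ < ρ → ∃ s : ℂ,
      HasSum (fun ν : ℕ => γ ν * (I * ξ) ^ ν / (Nat.factorial ν : ℂ)) s) :
    ∃ S : ℂ → ℂ, AnalyticAt ℂ S 0 ∧ S 0 = 0 ∧
      (∀ j, iteratedDeriv j S 0 / j.factorial = I ^ (2 * μ + j) * gco μ γ j) ∧
      ∀ ξ s : ℂ, ‖ξ‖ < ρ → HasSum (fun ν : ℕ => γ ν * (I * ξ) ^ ν / (Nat.factorial ν : ℂ)) s →
        s = ξ ^ (2 * μ) * S ξ := by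
  set c : ℕ → ℂ := fun j => I ^ (2 * μ + j) * gco μ γ j with hc
  have hc0 : c 0 = 0 := by simp [hc, gco, hγlow]
  have hshift : ∀ ξ s : ℂ, HasSum (fun ν : ℕ => γ ν * (I * ξ) ^ ν / (Nat.factorial ν : ℂ)) s →
      HasSum (fun j => ξ ^ (2 * μ) * (ξ ^ j * c j)) s := by
    intro ξ s h
    have h1 := (hasSum_nat_add_iff' (2 * μ)).2 h
    rw [Finset.sum_eq_zero, sub_zero] at h1
    · refine h1.congr_fun ?_
      intro j
      simp only [hc, gco]
      rw [add_comm j, mul_pow, pow_add ξ]; ring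
    · intro i hi
      rw [hγlow i (by simp at hi; omega)]; simp
  have hz : HasSum (fun j => (0:ℂ) ^ j * c j) 0 := by
    have : (fun j => (0:ℂ) ^ j * c j) = fun _ => 0 := by
      ext j; rcases j with _ | j <;> simp [hc0]
    rw [this]; exact hasSum_zero
  have hsum : ∀ ξ : ℂ, ‖ξ‖ < ρ → Summable fun j => ξ ^ j * c j := by
    intro ξ hξ
    by_cases h0 : ξ = 0
    · subst h0; exact hz.summable
    · obtain ⟨s, hs⟩ := hexp ξ hξ
      have h2 := (hshift ξ s hs).summable
      exact (summable_mul_left_iff (pow_ne_zero _ h0)).1 h2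
  have hF : HasFPowerSeriesAt (fun ξ : ℂ => ∑' j, ξ ^ j * c j) (FormalMultilinearSeries.ofScalars ℂ c) 0 := by
    rw [hasFPowerSeriesAt_iff]
    filter_upwards [Metric.ball_mem_nhds (0:ℂ) hρ] with ξ hξ
    simp only [FormalMultilinearSeries.coeff_ofScalars, smul_eq_mul, zero_add]
    exact (hsum ξ (by simpa using hξ)).hasSum
  refine ⟨fun ξ => ∑' j, ξ ^ j * c j, hF.analyticAt, hz.tsum_eq, ?_, ?_⟩
  · intro j
    have h1 := hF.analyticAt.hasFPowerSeriesAt.eq_formalMultilinearSeries hF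
    have h2 := congrArg (fun q => FormalMultilinearSeries.coeff q j) h1
    simpa [FormalMultilinearSeries.coeff_ofScalars] using h2
  · intro ξ s hξ hs
    exact (hshift ξ s hs).unique ((hsum ξ hξ).hasSum.mul_left _)

end

section
open MeasureTheory

lemma exists_tau (p : ℕ) (hp2 : 2 ≤ p) (b B r W : ℝ) (hb : 0 < b) (hr : 0 < r) :
    ∃ τ : ℝ, 0 < τ ∧ B * τ ^ (p - 1) ≤ 1 / 2 ∧ τ * W ≤ r ∧ B * (τ * W) ^ p ≤ b / 2 * r ^ p := by
  have h1 : ∀ᶠ τ : ℝ in nhds 0, B * τ ^ (p - 1) < 1 / 2 := by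
    have : Continuous fun τ : ℝ => B * τ ^ (p - 1) := by fun_prop
    apply this.continuousAt.eventually (gt_mem_nhds _)
    show B * (0:ℝ) ^ (p - 1) < 1 / 2
    rw [zero_pow (by omega)]; norm_num
  have h2 : ∀ᶠ τ : ℝ in nhds 0, τ * W < r := by
    have : Continuous fun τ : ℝ => τ * W := by fun_prop
    apply this.continuousAt.eventually (gt_mem_nhds _)
    simpa using hr
  have h3 : ∀ᶠ τ : ℝ in nhds 0, B * (τ * W) ^ p < b / 2 * r ^ p := by
    have : Continuous fun τ : ℝ => B * (τ * W) ^ p := by fun_prop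
    apply this.continuousAt.eventually (gt_mem_nhds _)
    show B * ((0:ℝ) * W) ^ p < b / 2 * r ^ p
    rw [zero_mul, zero_pow (by omega), mul_zero]; positivity
  obtain ⟨e, he, h⟩ := Metric.eventually_nhds_iff.1 (h1.and (h2.and h3))
  have := @h (e / 2) (by rw [Real.dist_eq, sub_zero, abs_of_pos (by positivity)]; linarith)
  exact ⟨e / 2, by positivity, this.1.le, this.2.1.le, this.2.2.le⟩

lemma tail_bound (μ : ℕ) (hμ : 1 ≤ μ) (β : ℂ) (hβ : 0 < β.re) (γ : ℕ → ℂ) (M : ℕ) (r : ℝ) (hr : 0 < r) :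
    ∃ C : ℝ, 0 < C ∧ ∀ N y : ℝ, 1 ≤ N →
      ‖(∫ ξ : ℝ, Tfun μ γ M N ξ * (exp (-I * y * ξ) * exp (-β * ((N : ℂ) ^ (2 * μ) * ξ ^ (2 * μ))))) -
        ∫ ξ in (-r)..r, Tfun μ γ M N ξ * 
          (exp (-I * y * ξ) * exp (-β * ((N : ℂ) ^ (2 * μ) * ξ ^ (2 * μ))))‖ ≤
      C * Real.exp (-(β.re / 4 * r ^ (2 * μ)) * N ^ (2 * μ)) := by
  obtain ⟨C, hC, hT⟩ := Tfun_bound μ hμ γ M (β.re / 2) (by positivity)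
  have hinteg := integrable_exp_pow (2 * μ) (even_two_mul μ) (by omega) (β.re / 4) (by positivity)
  have hJ : 0 ≤ ∫ t : ℝ, Real.exp (-(β.re / 4) * t ^ (2 * μ)) := integral_nonneg fun t => (Real.exp_pos _).le
  refine ⟨C * (1 + ∫ t : ℝ, Real.exp (-(β.re / 4) * t ^ (2 * μ))), by positivity, ?_⟩
  intro N y hN
  have hN0 : 0 < N := by linarith
  have hI := (Tfun_int μ hμ β hβ γ M N hN0 y).1
  rw [intervalIntegral.integral_of_le (by linarith), ← integral_Icc_eq_integral_Ioc,
    ← integral_add_compl (measurableSet_Icc (a := -r) (b := r)) hI, add_sub_cancel_left]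
  have hpt : ∀ ξ ∈ (Set.Icc (-r) r)ᶜ, ‖Tfun μ γ M N (ξ : ℝ) *
      (exp (-I * y * ξ) * exp (-β * ((N : ℂ) ^ (2 * μ) * ξ ^ (2 * μ))))‖ ≤
      C * Real.exp (-(β.re / 4 * r ^ (2 * μ)) * N ^ (2 * μ)) * Real.exp (-(β.re / 4) * ξ ^ (2 * μ)) := by
    intro ξ hξ
    have hξ2 : r ≤ |ξ| := by
      by_contra hh
      push Not at hh
      exact hξ (abs_le.1 hh.le)
    have hξ3 : r ^ (2 * μ) ≤ ξ ^ (2 * μ) := by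
      rw [← (even_two_mul μ).pow_abs ξ]; gcongr
    have hN1 : 1 ≤ N ^ (2 * μ) := one_le_pow₀ hN
    have hn : ‖exp (-I * y * ξ) * exp (-β * ((N : ℂ) ^ (2 * μ) * ξ ^ (2 * μ)))‖ =
        Real.exp (-β.re * (N ^ (2 * μ) * ξ ^ (2 * μ))) := by
      rw [norm_mul, norm_exp, norm_exp, ← ofReal_pow, ← ofReal_pow, ← ofReal_mul,
        show (-I * y * ξ : ℂ).re = 0 by simp, re_mul_ofReal, Real.exp_zero, one_mul, neg_re]
    rw [norm_mul, hn]
    calc _ ≤ (C * Real.exp (β.re / 2 * (N ^ (2 * μ) * ξ ^ (2 * μ)))) *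
        Real.exp (-β.re * (N ^ (2 * μ) * ξ ^ (2 * μ))) := by
          gcongr; exact hT N hN ξ
      _ ≤ _ := by
        rw [mul_assoc, mul_assoc, ← Real.exp_add, ← Real.exp_add]
        apply mul_le_mul_of_nonneg_left _ hC.le
        apply Real.exp_le_exp.2
        have h1 : r ^ (2 * μ) * N ^ (2 * μ) ≤ N ^ (2 * μ) * ξ ^ (2 * μ) := by
          rw [mul_comm]; gcongr
        have h2 : ξ ^ (2 * μ) ≤ N ^ (2 * μ) * ξ ^ (2 * μ) := 
          le_mul_of_one_le_left ((even_two_mul μ).pow_nonneg ξ) hN1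
        nlinarith
  have hinteg2 := hinteg.const_mul (C * Real.exp (-(β.re / 4 * r ^ (2 * μ)) * N ^ (2 * μ)))
  calc _ ≤ ∫ ξ in (Set.Icc (-r) r)ᶜ, C * Real.exp (-(β.re / 4 * r ^ (2 * μ)) * N ^ (2 * μ)) *
        Real.exp (-(β.re / 4) * ξ ^ (2 * μ)) := by
        apply norm_integral_le_of_norm_le hinteg2.integrableOn
        exact (ae_restrict_iff' measurableSet_Icc.compl).2 (Filter.Eventually.of_forall hpt)
    _ ≤ ∫ ξ : ℝ, C * Real.exp (-(β.re / 4 * r ^ (2 * μ)) * N ^ (2 * μ)) *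
        Real.exp (-(β.re / 4) * ξ ^ (2 * μ)) := by
        exact setIntegral_le_integral hinteg2 (Filter.Eventually.of_forall fun x => by
            simp only [Pi.zero_apply]; positivity)
    _ ≤ _ := by
        rw [integral_const_mul]
        have := Real.exp_pos (-(β.re / 4 * r ^ (2 * μ)) * N ^ (2 * μ))
        have h3 : 0 < C * Real.exp (-(β.re / 4 * r ^ (2 * μ)) * N ^ (2 * μ)) := by positivity
        nlinarith

lemma local_lemma (μ : ℕ) (hμ : 1 ≤ μ) (α : ℝ) (β : ℂ) (hβ : 0 < β.re) (γ : ℕ → ℂ)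
    (hγlow : ∀ ν : ℕ, ν < 2 * μ + 1 → γ ν = 0) (f : ℂ → ℂ) (ρ : ℝ) (hρ : 0 < ρ)
    (hexp : ∀ ξ : ℂ, ‖ξ‖ < ρ → ∃ s : ℂ,
      HasSum (fun ν : ℕ => γ ν * (I * ξ) ^ ν / (Nat.factorial ν : ℂ)) s ∧
      f ξ = exp (I * α * ξ - β * ξ ^ (2 * μ) + s)) :
    ∃ r1 : ℝ, 0 < r1 ∧ ∀ r : ℝ, 0 < r → r ≤ r1 → ∀ W : ℝ, 1 ≤ W → ∀ M : ℕ,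
      ∃ C : ℝ, 0 < C ∧ ∃ c : ℝ, 0 < c ∧ ∀ (n : ℕ) (N w y : ℝ), 1 ≤ N → 0 ≤ w → w ≤ W * N →
        |y| = N * w ^ (2 * μ - 1) → (n : ℝ) = N ^ (2 * μ) →
        ‖(1 / (2 * Real.pi : ℂ)) * (∫ ξ in (-r)..r, f ξ ^ n * exp (-I * (y + α * n) * ξ)) -
          ∑ m ∈ Finset.range (M + 1), ((N : ℂ) ^ (m + 1))⁻¹ * PdiffH μ γ m (Hfun μ β) (y / N)‖ ≤
        C * ((N ^ (M + 2))⁻¹ * Real.exp (-c * w ^ (2 * μ))) := by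
  obtain ⟨S, hS, hS0, hSc, hSs⟩ := exists_S μ γ hγlow ρ hρ (fun ξ hξ => (hexp ξ hξ).imp fun s h => h.1)
  obtain ⟨R0, hR0, hSd, hTay⟩ := taylor_main S hS hS0 (β.re / 8) (by positivity)
  obtain ⟨B, hB, hre⟩ := re_lower (2 * μ) (even_two_mul μ) β hβ
  set R := min R0 ρ with hR
  have hRpos : 0 < R := lt_min hR0 hρ
  refine ⟨R / 3, by positivity, fun r hr hrR W hW M => ?_⟩
  obtain ⟨τ, hτ, hτ1, hτ2, hτ3⟩ := exists_tau (2 * μ) (by omega) (β.re / 4) B r W (by positivity) hr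
  obtain ⟨C1, hC1, hT⟩ := hTay M
  obtain ⟨C2, hC2, hpow⟩ := pow_le_exp (M + 1) (2 * μ) (by omega) (β.re / 8) (by positivity)
  obtain ⟨C3, hC3, htail⟩ := tail_bound μ hμ β hβ γ M r hr
  set κ := β.re / 4 / 2 * r ^ (2 * μ) with hκ
  have hκ0 : 0 < κ := by positivity
  obtain ⟨C4, hC4, habs⟩ := absorb (M + 2) (2 * μ) (by omega) κ W hκ0 hW
  set J := ∫ t : ℝ, Real.exp (-(β.re / 4) * t ^ (2 * μ)) with hJdef
  have hJ : 0 ≤ J := integral_nonneg fun t => (Real.exp_pos _).le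
  refine ⟨C1 * C2 * J + 2 * (C1 * C2 * r) * C4 + C3 * C4, by positivity,
    min (τ / 2) (κ / (2 * W ^ (2 * μ))), lt_min (by positivity) (by positivity), ?_⟩
  intro n N w y hN hw hwW hy hn
  have hN0 : 0 < N := by linarith
  have hnC : (n : ℂ) = (N : ℂ) ^ (2 * μ) := by exact_mod_cast congrArg (fun x : ℝ => (x : ℂ)) hn
  set E : ℂ → ℂ := fun ξ => exp (-I * y * ξ) * exp (-β * ((N : ℂ) ^ (2 * μ) * ξ ^ (2 * μ))) with hE
  set g : ℂ → ℂ := fun ξ => (exp (((N : ℂ) ^ (2 * μ) * ξ ^ (2 * μ)) * S ξ) - Tfun μ γ M N ξ) * E ξ with hg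
  -- the integrand
  have hf : ∀ ξ : ℂ, ‖ξ‖ < R → f ξ ^ n * exp (-I * (y + α * n) * ξ) = g ξ + Tfun μ γ M N ξ * E ξ := by
    intro ξ hξ
    obtain ⟨s, hs, hfs⟩ := hexp ξ (hξ.trans_le (min_le_right _ _))
    have h1 := hSs ξ s (hξ.trans_le (min_le_right _ _)) hs
    rw [hfs, h1, ← exp_nat_mul, ← exp_add]
    simp only [hg, hE]
    rw [sub_mul, sub_add_cancel, ← exp_add, ← exp_add, hnC]
    congr 1; ring
  have hTdiff : Differentiable ℂ (Tfun μ γ M N) := by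
    have : Tfun μ γ M N = fun ξ => _ := funext fun ξ => Tfun_eq μ γ M N hN0 ξ
    rw [this]; fun_prop
  have hEdiff : Differentiable ℂ E := by rw [hE]; fun_prop
  have hgd : DifferentiableOn ℂ g (Metric.ball 0 R) := by
    have hSd' : DifferentiableOn ℂ S (Metric.ball 0 R) :=
      hSd.mono (Metric.ball_subset_ball (min_le_left _ _))
    have hp1 : Differentiable ℂ fun ξ : ℂ => (N : ℂ) ^ (2 * μ) * ξ ^ (2 * μ) := by fun_prop
    exact (((hp1.differentiableOn.mul hSd').cexp).sub hTdiff.differentiableOn).mul hEdiff.differentiableOn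
  set A := C1 * C2 * (N ^ (M + 1))⁻¹ with hA
  have hbd : ∀ s η : ℝ, ‖(s + η * I : ℂ)‖ < R → ‖g (s + η * I)‖ ≤
      A * Real.exp (y * η - N ^ (2 * μ) * (β.re / 4 * s ^ (2 * μ) - B * η ^ (2 * μ))) := by
    intro s η hξ
    have h1 := hre s η
    have h0 : (-I * y * (s + η * I : ℂ)).re = y * η := by simp
    set ξ : ℂ := s + η * I with hξdef
    have h2 := hT ((N : ℂ) ^ (2 * μ) * ξ ^ (2 * μ)) ξ (hξ.trans_le (min_le_left _ _))
    simp only [hSc] at h2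
    have h3 := hpow (N * ‖ξ‖) (by positivity)
    rw [mul_pow, mul_pow] at h3
    have h3' : ‖ξ‖ ^ (M + 1) ≤ C2 * (N ^ (M + 1))⁻¹ * Real.exp (β.re / 8 * (N ^ (2 * μ) * ‖ξ‖ ^ (2 * μ))) := by
      rw [mul_right_comm, ← div_eq_mul_inv, le_div_iff₀ (by positivity), mul_comm]
      exact h3
    have h4 : ‖E ξ‖ = Real.exp (y * η - N ^ (2 * μ) * (β * ξ ^ (2 * μ)).re) := by
      simp only [hE]
      rw [norm_mul, norm_exp, norm_exp, ← Real.exp_add, h0]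
      congr 1
      have : (-β * ((N : ℂ) ^ (2 * μ) * ξ ^ (2 * μ))) = ((-N ^ (2 * μ) : ℝ) : ℂ) * (β * ξ ^ (2 * μ)) := by
        push_cast; ring
      rw [this, re_ofReal_mul]; ring
    have h5 : ‖(N : ℂ) ^ (2 * μ) * ξ ^ (2 * μ)‖ = N ^ (2 * μ) * ‖ξ‖ ^ (2 * μ) := by
      rw [norm_mul, norm_pow, norm_pow, norm_real, Real.norm_eq_abs, abs_of_pos hN0]
    rw [h5] at h2
    simp only [hg]
    rw [norm_mul, h4]
    calc _ ≤ (C1 * ‖ξ‖ ^ (M + 1) * Real.exp (β.re / 8 * (N ^ (2 * μ) * ‖ξ‖ ^ (2 * μ)))) *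
          Real.exp (y * η - N ^ (2 * μ) * (β * ξ ^ (2 * μ)).re) := by
            gcongr; exact h2
      _ ≤ (C1 * (C2 * (N ^ (M + 1))⁻¹ * Real.exp (β.re / 8 * (N ^ (2 * μ) * ‖ξ‖ ^ (2 * μ)))) *
          Real.exp (β.re / 8 * (N ^ (2 * μ) * ‖ξ‖ ^ (2 * μ)))) *
          Real.exp (y * η - N ^ (2 * μ) * (β * ξ ^ (2 * μ)).re) := by gcongr
      _ = A * Real.exp (y * η - N ^ (2 * μ) * ((β * ξ ^ (2 * μ)).re - β.re / 4 * ‖ξ‖ ^ (2 * μ))) := by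
          rw [show y * η - N ^ (2 * μ) * ((β * ξ ^ (2 * μ)).re - β.re / 4 * ‖ξ‖ ^ (2 * μ)) =
            β.re / 8 * (N ^ (2 * μ) * ‖ξ‖ ^ (2 * μ)) + β.re / 8 * (N ^ (2 * μ) * ‖ξ‖ ^ (2 * μ)) +
            (y * η - N ^ (2 * μ) * (β * ξ ^ (2 * μ)).re) by ring, Real.exp_add, Real.exp_add, hA]
          ring
      _ ≤ _ := by gcongr
  have hmain := contour_bound (2 * μ) (even_two_mul μ) (by omega) g R r A (β.re / 4) B N w W y τ hr
    (by linarith) hgd (by positivity) (by positivity) hB.le hN hw hwW hy hτ hτ1 hτ2 hτ3 hbd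
  have ht := htail N y hN
  have hTi := (Tfun_int μ hμ β hβ γ M N hN0 y)
  have hab := habs N w hN hw hwW
  rw [hTi.2, ← mul_sub]
  have hsplit : (∫ ξ in (-r)..r, f ξ ^ n * exp (-I * (y + α * n) * ξ)) =
      (∫ ξ in (-r)..r, g ξ) + ∫ ξ in (-r)..r, Tfun μ γ M N ξ * E ξ := by
    rw [← intervalIntegral.integral_add]
    · apply intervalIntegral.integral_congr
      intro ξ hξ
      rw [Set.uIcc_of_le (by linarith)] at hξ
      apply hf
      rw [norm_real, Real.norm_eq_abs]
      have := abs_le.2 hξ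
      linarith
    · apply ContinuousOn.intervalIntegrable
      apply hgd.continuousOn.comp (continuous_ofReal.continuousOn)
      intro ξ hξ
      rw [Set.uIcc_of_le (by linarith)] at hξ
      have := abs_le.2 hξ
      simp
      linarith
    · apply Continuous.intervalIntegrable
      exact (hTdiff.continuous.comp continuous_ofReal).mul (hEdiff.continuous.comp continuous_ofReal)
  rw [hsplit, norm_mul]
  have hpi : ‖(1 / (2 * Real.pi : ℂ))‖ ≤ 1 := by
    rw [norm_div, norm_one, norm_mul, norm_real, Real.norm_eq_abs, abs_of_pos Real.pi_pos]
    rw [div_le_one (by simp [Real.pi_pos])]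
    simp only [Complex.norm_ofNat]
    linarith [Real.pi_gt_three]
  have hred : ‖(∫ ξ in (-r)..r, g ξ) + (∫ ξ in (-r)..r, Tfun μ γ M N ξ * E ξ) -
      ∫ ξ : ℝ, Tfun μ γ M N ξ * E ξ‖ ≤ ‖∫ ξ in (-r)..r, g ξ‖ +
      C3 * Real.exp (-(β.re / 4 * r ^ (2 * μ)) * N ^ (2 * μ)) := by
    rw [add_sub_assoc]
    refine (norm_add_le _ _).trans ?_
    rw [norm_sub_rev (∫ ξ in (-r)..r, Tfun μ γ M N ξ * E ξ)]
    gcongr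
  refine (mul_le_of_le_one_left (norm_nonneg _) hpi).trans (hred.trans ?_)
  set c := min (τ / 2) (κ / (2 * W ^ (2 * μ))) with hc
  set D := (N ^ (M + 2))⁻¹ * Real.exp (-c * w ^ (2 * μ)) with hD
  have hwp : 0 ≤ w ^ (2 * μ) := by positivity
  have hD1 : (N ^ (M + 2))⁻¹ * Real.exp (-(κ / (2 * W ^ (2 * μ))) * w ^ (2 * μ)) ≤ D := by
    rw [hD]; gcongr; exact min_le_right _ _
  have hD2 : (N ^ (M + 2))⁻¹ * Real.exp (-(τ / 2) * w ^ (2 * μ)) ≤ D := by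
    rw [hD]; gcongr; exact min_le_left _ _
  have hab2 : Real.exp (-κ * N ^ (2 * μ)) ≤ C4 * D := hab.trans (by gcongr)
  have hab3 : Real.exp (-(β.re / 4 * r ^ (2 * μ)) * N ^ (2 * μ)) ≤ C4 * D := by
    refine le_trans ?_ hab2
    apply Real.exp_le_exp.2
    have : 0 ≤ r ^ (2 * μ) * N ^ (2 * μ) := by positivity
    rw [hκ]; nlinarith
  have hA1 : A ≤ C1 * C2 := by
    rw [hA]
    exact mul_le_of_le_one_right (by positivity) (inv_le_one_of_one_le₀ (one_le_pow₀ hN))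
  calc _ ≤ (A * (N⁻¹ * J) * Real.exp (-(τ / 2) * w ^ (2 * μ)) +
        2 * (A * r) * Real.exp (-κ * N ^ (2 * μ))) + C3 * (C4 * D) :=
        add_le_add hmain (mul_le_mul_of_nonneg_left hab3 hC3.le)
    _ ≤ (C1 * C2 * J * D + 2 * (C1 * C2 * r) * (C4 * D)) + C3 * (C4 * D) := by
        gcongr ?_ + ?_ + _
        · calc _ = C1 * C2 * J * ((N ^ (M + 2))⁻¹ * Real.exp (-(τ / 2) * w ^ (2 * μ))) := by
                rw [hA, pow_succ N (M + 1), mul_inv]; ring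
            _ ≤ _ := by gcongr
        · gcongr
    _ = _ := by ring

end

section
open MeasureTheory

lemma exists_pos_le {ι : Type} [Finite ι] (f : ι → ℝ) (hf : ∀ i, 0 < f i) :
    ∃ c : ℝ, 0 < c ∧ ∀ i, c ≤ f i := by
  rcases isEmpty_or_nonempty ι with h | h
  · exact ⟨1, one_pos, fun i => (h.false i).elim⟩
  · obtain ⟨i, hi⟩ := Finite.exists_min f
    exact ⟨f i, hf i, hi⟩

lemma scale_lemma (μ : ℕ) (hμ : 1 ≤ μ) (α : ℝ) (n : ℕ) (hn : 1 ≤ n) (l : ℝ) (hl : |l| ≤ n) :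
    1 ≤ (n : ℝ) ^ ((1 : ℝ) / (2 * (μ : ℝ))) ∧
    (n : ℝ) = ((n : ℝ) ^ ((1 : ℝ) / (2 * (μ : ℝ)))) ^ (2 * μ) ∧
    (∀ j : ℕ, (n : ℝ) ^ (-(j : ℝ) / (2 * (μ : ℝ))) =
      (((n : ℝ) ^ ((1 : ℝ) / (2 * (μ : ℝ)))) ^ j)⁻¹) ∧
    ∃ w : ℝ, 0 ≤ w ∧ w ≤ (1 + |α|) * (n : ℝ) ^ ((1 : ℝ) / (2 * (μ : ℝ))) ∧
      |l - α * n| = (n : ℝ) ^ ((1 : ℝ) / (2 * (μ : ℝ))) * w ^ (2 * μ - 1) ∧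
      w ^ (2 * μ) = (|l - α * n| / (n : ℝ) ^ ((1 : ℝ) / (2 * (μ : ℝ)))) ^
        ((2 * (μ : ℝ)) / (2 * (μ : ℝ) - 1)) := by
  have hn1 : (1 : ℝ) ≤ n := by exact_mod_cast hn
  have hμ1 : (1 : ℝ) ≤ μ := by exact_mod_cast hμ
  have hn0 : (0 : ℝ) ≤ n := by linarith
  have hN1 : 1 ≤ (n : ℝ) ^ ((1 : ℝ) / (2 * (μ : ℝ))) := Real.one_le_rpow hn1 (by positivity)
  have hnN : (n : ℝ) = ((n : ℝ) ^ ((1 : ℝ) / (2 * (μ : ℝ)))) ^ (2 * μ) := by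
    rw [← Real.rpow_natCast, ← Real.rpow_mul hn0]
    push_cast
    rw [one_div_mul_cancel (by positivity), Real.rpow_one]
  refine ⟨hN1, hnN, ?_, ?_⟩
  · intro j
    rw [← Real.rpow_natCast, ← Real.rpow_mul hn0, ← Real.rpow_neg hn0]
    congr 1; ring
  set N := (n : ℝ) ^ ((1 : ℝ) / (2 * (μ : ℝ))) with hN
  have hN0 : 0 < N := by linarith
  set v := |l - α * n| / N with hv
  have hv0 : 0 ≤ v := by positivity
  have hcast : ((2 * μ - 1 : ℕ) : ℝ) = 2 * (μ : ℝ) - 1 := by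
    rw [Nat.cast_sub (by omega)]; push_cast; ring
  have h21 : (0 : ℝ) < 2 * (μ : ℝ) - 1 := by linarith
  have hwpow : (v ^ ((1 : ℝ) / (2 * (μ : ℝ) - 1))) ^ (2 * μ - 1) = v := by
    rw [← Real.rpow_natCast, ← Real.rpow_mul hv0, hcast, one_div_mul_cancel h21.ne', Real.rpow_one]
  have hw0 : 0 ≤ v ^ ((1 : ℝ) / (2 * (μ : ℝ) - 1)) := by positivity
  refine ⟨v ^ ((1 : ℝ) / (2 * (μ : ℝ) - 1)), hw0, ?_, ?_, ?_⟩
  · refine (pow_le_pow_iff_left₀ hw0 (by positivity) (show 2 * μ - 1 ≠ 0 by omega)).1 ?_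
    rw [hwpow, hv, div_le_iff₀ hN0]
    have h1 : |l - α * n| ≤ (1 + |α|) * n := by
      calc _ ≤ |l| + |α * n| := abs_sub _ _
        _ = |l| + |α| * n := by rw [abs_mul, abs_of_nonneg hn0]
        _ ≤ _ := by linarith
    have h2 : (1 + |α|) ≤ (1 + |α|) ^ (2 * μ - 1) :=
      le_self_pow₀ (by linarith [abs_nonneg α]) (by omega)
    calc _ ≤ (1 + |α|) * n := h1
      _ = (1 + |α|) * N ^ (2 * μ - 1 + 1) := by
          rw [show 2 * μ - 1 + 1 = 2 * μ by omega, ← hnN]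
      _ ≤ (1 + |α|) ^ (2 * μ - 1) * N ^ (2 * μ - 1 + 1) := by gcongr
      _ = _ := by rw [mul_pow, pow_succ]; ring
  · rw [hwpow, hv]; field_simp
  · rw [← Real.rpow_natCast, ← Real.rpow_mul hv0]
    congr 1
    push_cast; ring

lemma off_arcs {K : ℕ} (F : ℂ → ℂ) (hF : ContinuousOn F {z | ‖z‖ = 1}) (κ : Fin K → ℂ)
    (hκmod : ∀ k, ‖κ k‖ = 1) (hlt : ∀ z : ℂ, ‖z‖ = 1 → (∀ k, z ≠ κ k) → ‖F z‖ < 1)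
    (r : ℝ) (hr : 0 < r) (hrpi : r < Real.pi) :
    ∃ κ0 : ℝ, 0 < κ0 ∧ ∀ z, ‖z‖ = 1 → (∀ k, (z / κ k).re < Real.cos r) →
      ‖F z‖ ≤ Real.exp (-κ0) := by
  have hcos : Real.cos r < 1 := by
    have := Real.cos_lt_cos_of_nonneg_of_le_pi le_rfl hrpi.le hr
    simpa using this
  set T : Set ℂ := Metric.sphere 0 1 ∩ {z | ∀ k, (z / κ k).re ≤ Real.cos r} with hT
  have hTc : IsCompact T := by
    apply (isCompact_sphere 0 1).inter_right
    rw [Set.ofPred_forall]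
    apply isClosed_iInter
    intro k
    exact isClosed_le (continuous_re.comp (continuous_id.div_const _)) continuous_const
  have hTlt : ∀ z ∈ T, ‖F z‖ < 1 := by
    intro z hz
    apply hlt z (by simpa using hz.1)
    rintro k rfl
    have h0 : κ k ≠ 0 := by intro h; have := hκmod k; rw [h] at this; simp at this
    have := hz.2 k
    rw [div_self h0, one_re] at this
    linarith
  have hFT : ContinuousOn (fun z => ‖F z‖) T :=
    (hF.mono fun z hz => by simpa using hz.1).norm
  obtain ⟨q, hq1, hq⟩ : ∃ q : ℝ, q < 1 ∧ ∀ z ∈ T, ‖F z‖ ≤ q := by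
    rcases T.eq_empty_or_nonempty with h | h
    · exact ⟨0, one_pos, by simp [h]⟩
    · obtain ⟨z, hz, hm⟩ := hTc.exists_isMaxOn h hFT
      exact ⟨_, hTlt z hz, fun x hx => hm hx⟩
  have hq' : max q (1/2) < 1 := max_lt hq1 (by norm_num)
  have hq0 : 0 < max q (1/2) := lt_max_of_lt_right (by norm_num)
  refine ⟨-Real.log (max q (1/2)), by linarith [Real.log_neg hq0 hq'], fun z hz h => ?_⟩
  rw [neg_neg, Real.exp_log hq0]
  exact (hq z ⟨by simpa using hz, fun k => (h k).le⟩).trans (le_max_left _ _)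

end

/-- Complete asymptotic expansion, with sharp generalized Gaussian remainder bounds, of the
iterated convolutions `a^{⋆n}_ℓ` in the sector `|ℓ| ≤ L n`. -/
theorem local_limit_expansion
    (a : ℤ → ℂ) (ha : Summable fun ℓ : ℤ => ‖a ℓ‖)
    (ε : ℝ) (hε : 0 < ε) (F : ℂ → ℂ)
    (hFsum : ∀ ζ : ℂ, 1 - ε < ‖ζ‖ → ‖ζ‖ < 1 + ε →
      HasSum (fun ℓ : ℤ => a ℓ * ζ ^ ℓ) (F ζ))
    (hFhol : DifferentiableOn ℂ F {ζ : ℂ | 1 - ε < ‖ζ‖ ∧ ‖ζ‖ < 1 + ε})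
    (hFsup : IsLUB {y : ℝ | ∃ κ : ℂ, ‖κ‖ = 1 ∧ y = ‖F κ‖} 1)
    (K : ℕ) (hK : 1 ≤ K) (κ : Fin K → ℂ) (hκinj : Function.Injective κ)
    (hκmod : ∀ k, ‖κ k‖ = 1)
    (hκtang : ∀ k, ‖F (κ k)‖ = 1)
    (hlt : ∀ z : ℂ, ‖z‖ = 1 → (∀ k, z ≠ κ k) → ‖F z‖ < 1)
    (α : Fin K → ℝ) (β : Fin K → ℂ) (hβ : ∀ k, 0 < (β k).re)
    (μ : Fin K → ℕ) (hμ : ∀ k, 1 ≤ μ k)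
    (γ : Fin K → ℕ → ℂ) (hγlow : ∀ k, ∀ ν : ℕ, ν < 2 * μ k + 1 → γ k ν = 0)
    (hexp : ∀ k, ∃ ρ : ℝ, 0 < ρ ∧ ∀ ξ : ℂ, ‖ξ‖ < ρ → ∃ s : ℂ,
      HasSum (fun ν : ℕ => γ k ν * (Complex.I * ξ) ^ ν / (Nat.factorial ν : ℂ)) s ∧
      F (κ k * Complex.exp (Complex.I * ξ)) =
        F (κ k) * Complex.exp (Complex.I * (α k) * ξ - β k * ξ ^ (2 * μ k) + s)) :
    ∃ L : ℕ, 1 ≤ L ∧ ∀ M : ℕ, ∃ C : ℝ, 0 < C ∧ ∃ c : ℝ, 0 < c ∧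
      ∀ n : ℕ, 1 ≤ n → ∀ ℓ : ℤ, |ℓ| ≤ (L : ℤ) * n →
        ‖iterConv a (n - 1) ℓ -
            ∑ k : Fin K, ∑ m ∈ Finset.range (M + 1),
              κ k ^ (-ℓ) * F (κ k) ^ n *
                (((n : ℝ) ^ (-((m : ℝ) + 1) / (2 * (μ k : ℝ))) : ℝ) : ℂ) *
                PdiffH (μ k) (γ k) m (Hfun (μ k) (β k))
                  (((ℓ : ℝ) - α k * n) / (n : ℝ) ^ ((1 : ℝ) / (2 * (μ k : ℝ))))‖ ≤
          C * ∑ k : Fin K,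
            (n : ℝ) ^ (-((M : ℝ) + 2) / (2 * (μ k : ℝ))) *
              Real.exp (-c *
                (|(ℓ : ℝ) - α k * n| / (n : ℝ) ^ ((1 : ℝ) / (2 * (μ k : ℝ)))) ^
                  ((2 * (μ k : ℝ)) / (2 * (μ k : ℝ) - 1))) := by
  have hann : ∀ z : ℂ, ‖z‖ = 1 → 1 - ε < ‖z‖ ∧ ‖z‖ < 1 + ε := fun z hz => by
    rw [hz]; constructor <;> linarith
  have hFc : ContinuousOn F {z | ‖z‖ = 1} := hFhol.continuousOn.mono hann
  have hκ0 : ∀ k, κ k ≠ 0 := fun k h => by have := hκmod k; rw [h] at this; simp at this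
  have hF0 : ∀ k, F (κ k) ≠ 0 := fun k h => by have := hκtang k; rw [h] at this; simp at this
  set f : Fin K → ℂ → ℂ := fun k ξ => F (κ k * exp (I * ξ)) / F (κ k) with hf
  choose ρ hρ hexp2 using hexp
  have hloc := fun k => local_lemma (μ k) (hμ k) (α k) (β k) (hβ k) (γ k) (hγlow k) (f k)
    (ρ k) (hρ k) (fun ξ hξ => by
      obtain ⟨s, hs, hs2⟩ := hexp2 k ξ hξ
      refine ⟨s, hs, ?_⟩
      simp only [hf]
      rw [hs2, mul_div_cancel_left₀ _ (hF0 k)])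
  choose r1 hr1 hloc using hloc
  obtain ⟨ra, hra, hra1⟩ := exists_pos_le r1 hr1
  obtain ⟨rb, hrb, hrb1⟩ := exists_pos_le
    (fun p : Fin K × Fin K => if p.1 = p.2 then 1 else ‖κ p.1 - κ p.2‖) (fun p => by
      split_ifs with h
      · exact one_pos
      · exact norm_pos_iff.2 (sub_ne_zero.2 fun h' => h (hκinj h')))
  set r := min (min ra 1) (rb / 3) with hrdef
  have hr : 0 < r := lt_min (lt_min hra one_pos) (by positivity)
  have hr_a : ∀ k, r ≤ r1 k := fun k =>
    ((min_le_left _ _).trans (min_le_left _ _)).trans (hra1 k)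
  have hr_pi : r < Real.pi := lt_of_le_of_lt ((min_le_left _ _).trans (min_le_right _ _))
    (by linarith [Real.pi_gt_three])
  have hr_b : ∀ k j, k ≠ j → 2 * r < ‖κ k - κ j‖ := by
    intro k j hkj
    have h1 := hrb1 (k, j)
    simp only [if_neg hkj] at h1
    have h2 : r ≤ rb / 3 := min_le_right _ _
    linarith
  obtain ⟨κ0, hκpos, hoff⟩ := off_arcs F hFc κ hκmod hlt r hr hr_pi
  refine ⟨1, le_rfl, fun M => ?_⟩
  have hWk : ∀ k, 1 ≤ 1 + |α k| := fun k => by linarith [abs_nonneg (α k)]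
  have hloc2 := fun k => hloc k r hr (hr_a k) (1 + |α k|) (hWk k) M
  choose C hC c hc hloc2 using hloc2
  set k0 : Fin K := ⟨0, hK⟩ with hk0
  obtain ⟨C', hC', habs⟩ := absorb (M + 2) (2 * μ k0) (by have := hμ k0; omega) κ0 (1 + |α k0|)
    hκpos (hWk k0)
  set c' := κ0 / (2 * (1 + |α k0|) ^ (2 * μ k0)) with hc'def
  have hc' : 0 < c' := by have := hWk k0; positivity
  obtain ⟨cm, hcm, hcm1⟩ := exists_pos_le c hc
  refine ⟨(∑ k, C k) + C', by
    have := Finset.sum_nonneg fun k (_ : k ∈ Finset.univ) => (hC k).le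
    linarith, min cm c', lt_min hcm hc', ?_⟩
  intro n hn ℓ hℓ
  have hl : |(ℓ : ℝ)| ≤ n := by
    have : ((|ℓ| : ℤ) : ℝ) ≤ ((((1 : ℕ) : ℤ) * (n : ℤ) : ℤ) : ℝ) := by exact_mod_cast hℓ
    simpa using this
  have hsc := fun k => scale_lemma (μ k) (hμ k) (α k) n hn ℓ hl
  choose hN1 hnN hNj w hw hwW hy hwp using hsc
  set N : Fin K → ℝ := fun k => (n : ℝ) ^ ((1 : ℝ) / (2 * (μ k : ℝ))) with hN
  -- the integral representation
  have hrep : iterConv a (n - 1) ℓ = (1 / (2 * Real.pi : ℂ)) *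
      ∫ θ in (-Real.pi)..Real.pi, F (exp (I * θ)) ^ n * (exp (I * θ)) ^ (-ℓ) := by
    have hs := iterConv_spec a ha (n - 1)
    have := coeff_integral (iterConv a (n - 1)) hs.1 (fun z => F z ^ n) (fun z hz => by
      have := hs.2 z (F z) hz (hFsum z (hann z hz).1 (hann z hz).2)
      rwa [Nat.sub_add_cancel hn] at this) ℓ
    exact this
  have harc := arcs_bound κ hκmod r hr hr_pi hr_b (fun z => F z ^ n * z ^ (-ℓ))
    ((hFc.pow n).mul fun z hz => (continuousAt_zpow₀ z (-ℓ)
      (Or.inl (by rintro rfl; simp at hz))).continuousWithinAt)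
    (Real.exp (-κ0 * n)) (Real.exp_pos _).le (fun z hz h => by
      rw [norm_mul, norm_pow, norm_zpow, hz, one_zpow, mul_one]
      calc _ ≤ Real.exp (-κ0) ^ n := pow_le_pow_left₀ (norm_nonneg _) (hoff z hz h) n
        _ = _ := by rw [← Real.exp_nat_mul]; congr 1; ring)
  have hI : ∀ k, ∫ ξ in (-r)..r, F (κ k * exp (I * ξ)) ^ n * (κ k * exp (I * ξ)) ^ (-ℓ) =
      κ k ^ (-ℓ) * F (κ k) ^ n * ∫ ξ in (-r)..r, f k ξ ^ n *
        exp (-I * (((ℓ - α k * n : ℝ) : ℂ) + α k * n) * ξ) := by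
    intro k
    rw [← intervalIntegral.integral_const_mul]
    congr 1
    funext ξ
    simp only [hf]
    rw [mul_zpow, ← exp_int_mul, div_pow]
    have h1 : F (κ k) ^ n ≠ 0 := pow_ne_zero _ (hF0 k)
    have h2 : (((-ℓ : ℤ) : ℂ)) * (I * ξ) = -I * (((ℓ - α k * n : ℝ) : ℂ) + α k * n) * ξ := by
      push_cast; ring
    rw [h2]
    field_simp
  simp only [hI] at harc
  set B : Fin K → ℝ := fun k => (n : ℝ) ^ (-((M : ℝ) + 2) / (2 * (μ k : ℝ))) *
    Real.exp (-(min cm c') * (|(ℓ : ℝ) - α k * n| / (n : ℝ) ^ ((1 : ℝ) / (2 * (μ k : ℝ)))) ^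
      ((2 * (μ k : ℝ)) / (2 * (μ k : ℝ) - 1))) with hB
  have hBeq : ∀ k, B k = (N k ^ (M + 2))⁻¹ * Real.exp (-(min cm c') * w k ^ (2 * μ k)) := by
    intro k
    simp only [hB]
    rw [← hwp k, ← hNj k (M + 2)]
    push_cast
    rfl
  have hBpos : ∀ k, 0 ≤ B k := fun k => by simp only [hB]; positivity
  have hBsum : ∀ k, B k ≤ ∑ k, B k := fun k =>
    Finset.single_le_sum (fun j _ => hBpos j) (Finset.mem_univ k)
  have hterm : ∀ k, ‖(1 / (2 * Real.pi : ℂ)) * (κ k ^ (-ℓ) * F (κ k) ^ n *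
        ∫ ξ in (-r)..r, f k ξ ^ n * exp (-I * (((ℓ - α k * n : ℝ) : ℂ) + α k * n) * ξ)) -
      ∑ m ∈ Finset.range (M + 1), κ k ^ (-ℓ) * F (κ k) ^ n *
        (((n : ℝ) ^ (-((m : ℝ) + 1) / (2 * (μ k : ℝ))) : ℝ) : ℂ) *
        PdiffH (μ k) (γ k) m (Hfun (μ k) (β k))
          (((ℓ : ℝ) - α k * n) / (n : ℝ) ^ ((1 : ℝ) / (2 * (μ k : ℝ))))‖ ≤ C k * B k := by
    intro k
    have h := hloc2 k n (N k) (w k) (ℓ - α k * n) (hN1 k) (hw k) (hwW k) (hy k) (hnN k)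
    have hpre : ‖κ k ^ (-ℓ) * F (κ k) ^ n‖ = 1 := by
      rw [norm_mul, norm_zpow, norm_pow, hκmod, hκtang, one_zpow, one_pow, one_mul]
    have hsum : ∑ m ∈ Finset.range (M + 1), κ k ^ (-ℓ) * F (κ k) ^ n *
        (((n : ℝ) ^ (-((m : ℝ) + 1) / (2 * (μ k : ℝ))) : ℝ) : ℂ) *
        PdiffH (μ k) (γ k) m (Hfun (μ k) (β k))
          (((ℓ : ℝ) - α k * n) / (n : ℝ) ^ ((1 : ℝ) / (2 * (μ k : ℝ)))) =
        κ k ^ (-ℓ) * F (κ k) ^ n * ∑ m ∈ Finset.range (M + 1), ((N k : ℂ) ^ (m + 1))⁻¹ *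
          PdiffH (μ k) (γ k) m (Hfun (μ k) (β k)) ((ℓ - α k * n) / N k) := by
      rw [Finset.mul_sum]
      apply Finset.sum_congr rfl
      intro m _
      have h1 := hNj k (m + 1)
      push_cast at h1
      rw [h1, mul_assoc]
      push_cast
      rfl
    rw [hsum, mul_left_comm, ← mul_sub, norm_mul, hpre, one_mul]
    refine h.trans ?_
    rw [hBeq k]
    have := hC k
    have h3 : min cm c' ≤ c k := (min_le_left _ _).trans (hcm1 k)
    have h4 : 0 ≤ w k ^ (2 * μ k) := pow_nonneg (hw k) _
    have h5 : 0 < N k := lt_of_lt_of_le one_pos (hN1 k)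
    gcongr
  have hout : Real.exp (-κ0 * n) ≤ C' * B k0 := by
    have h := habs (N k0) (w k0) (hN1 k0) (hw k0) (hwW k0)
    rw [← hnN k0] at h
    refine h.trans ?_
    rw [hBeq k0]
    have h3 : min cm c' ≤ c' := min_le_right _ _
    have h4 : 0 ≤ w k0 ^ (2 * μ k0) := pow_nonneg (hw k0) _
    have h5 : 0 < N k0 := lt_of_lt_of_le one_pos (hN1 k0)
    gcongr
  rw [hrep]
  set Itot := ∫ θ in (-Real.pi)..Real.pi, F (exp (I * θ)) ^ n * (exp (I * θ)) ^ (-ℓ) with hItot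
  set Ik : Fin K → ℂ := fun k => κ k ^ (-ℓ) * F (κ k) ^ n *
        ∫ ξ in (-r)..r, f k ξ ^ n * exp (-I * (((ℓ - α k * n : ℝ) : ℂ) + α k * n) * ξ) with hIk
  have hpi : ‖(1 / (2 * Real.pi : ℂ))‖ = 1 / (2 * Real.pi) := by
    rw [norm_div, norm_one, norm_mul, norm_real, Real.norm_eq_abs, abs_of_pos Real.pi_pos,
      Complex.norm_ofNat]
  have hA : ‖(1 / (2 * Real.pi : ℂ)) * (Itot - ∑ k, Ik k)‖ ≤ Real.exp (-κ0 * n) := by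
    rw [norm_mul, hpi]
    calc _ ≤ 1 / (2 * Real.pi) * (2 * Real.pi * Real.exp (-κ0 * n)) := by gcongr
      _ = _ := by have := Real.pi_pos; field_simp
  set Sk : Fin K → ℂ := fun k => ∑ m ∈ Finset.range (M + 1), κ k ^ (-ℓ) * F (κ k) ^ n *
        (((n : ℝ) ^ (-((m : ℝ) + 1) / (2 * (μ k : ℝ))) : ℝ) : ℂ) *
        PdiffH (μ k) (γ k) m (Hfun (μ k) (β k))
          (((ℓ : ℝ) - α k * n) / (n : ℝ) ^ ((1 : ℝ) / (2 * (μ k : ℝ)))) with hSk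
  have hfin : ‖(1 / (2 * Real.pi : ℂ)) * Itot - ∑ k, Sk k‖ ≤ ((∑ k, C k) + C') * ∑ k, B k := by
    have e : (1 / (2 * Real.pi : ℂ)) * Itot - ∑ k, Sk k =
        (1 / (2 * Real.pi : ℂ)) * (Itot - ∑ k, Ik k) +
          ∑ k, ((1 / (2 * Real.pi : ℂ)) * Ik k - Sk k) := by
      rw [Finset.sum_sub_distrib, ← Finset.mul_sum]; ring
    rw [e]
    calc _ ≤ Real.exp (-κ0 * n) + ∑ k, C k * B k :=
          (norm_add_le _ _).trans (add_le_add hA (norm_sum_le_of_le _ fun k _ => hterm k))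
      _ ≤ C' * (∑ k, B k) + ∑ k, C k * ∑ k, B k := by
          refine add_le_add (hout.trans (mul_le_mul_of_nonneg_left (hBsum k0) hC'.le)) ?_
          exact Finset.sum_le_sum fun k _ => mul_le_mul_of_nonneg_left (hBsum k) (hC k).le
      _ = _ := by rw [← Finset.sum_mul]; ring
  exact hfin
end
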